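/- Theorem 2.1(iii): Suppose the measurable coefficients a^{ij} on ℝ^d satisfy ν|ξ|² ≤ a^{ij}(x)ξ^iξ^j and Σ_{i,j}|a^{ij}(x)|² ≤ ν^{−2} for all x, ξ, and are independent of x', i.e. a^{ij}(x',x'') = a^{ij}(y',x'') for all x', y', x''. Let δ ∈ (0,1), let f⃗ = (f^1,…,f^d) : B_1 → ℝ^d satisfy [f⃗]_{x',δ;B_1} := max_i [f^i]_{x',δ;B_1} < ∞, and let u be a bounded weak solution of D_i(a^{ij}D_j u) = div f⃗ in B_1. Then there is a constant N depending only on d, q, ν, δ such that [u]_{x',1+δ;B_{1/2}} ≤ N ( [f⃗]_{x',δ;B_1} + sup_{B_1} |u| ). -/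

import Mathlib

open MeasureTheory Metric Set Filter

noncomputable section

/-- First-order partial derivative `D_i`. -/
def pd {d : ℕ} (i : Fin d) (v : EuclideanSpace ℝ (Fin d) → ℝ)
    (x : EuclideanSpace ℝ (Fin d)) : ℝ :=
  fderiv ℝ v x (EuclideanSpace.single i 1)

/-- Second-order partial derivative `D_i D_j`. -/
def pd2 {d : ℕ} (i j : Fin d) (v : EuclideanSpace ℝ (Fin d) → ℝ)
    (x : EuclideanSpace ℝ (Fin d)) : ℝ :=
  pd i (fun y => pd j v y) x

/-- Partial Hölder bound with respect to the first `q` coordinates: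
`|g x - g y| ≤ K |x' - y'|^δ` whenever `x'' = y''` (note `dist x y = |x' - y'|` then). -/
def PHolderX (d q : ℕ) (δ : ℝ) (Ω : Set (EuclideanSpace ℝ (Fin d)))
    (g : EuclideanSpace ℝ (Fin d) → ℝ) (K : ℝ) : Prop :=
  ∀ x ∈ Ω, ∀ y ∈ Ω, (∀ i : Fin d, q ≤ (i : ℕ) → x i = y i) →
    |g x - g y| ≤ K * dist x y ^ δ

/-- Full Hölder bound. -/
def HolderB {d : ℕ} (δ : ℝ) (Ω : Set (EuclideanSpace ℝ (Fin d)))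
    (g : EuclideanSpace ℝ (Fin d) → ℝ) (K : ℝ) : Prop :=
  ∀ x ∈ Ω, ∀ y ∈ Ω, |g x - g y| ≤ K * dist x y ^ δ

/-- Uniform ellipticity with constant `ν` (two-sided bound). -/
def UnifElliptic (d : ℕ) (ν : ℝ)
    (a : Fin d → Fin d → EuclideanSpace ℝ (Fin d) → ℝ) : Prop :=
  ∀ (x : EuclideanSpace ℝ (Fin d)) (ξ : Fin d → ℝ),
    ν * ∑ i, ξ i ^ 2 ≤ ∑ i, ∑ j, a i j x * ξ i * ξ j ∧
      ∑ i, ∑ j, a i j x * ξ i * ξ j ≤ ν⁻¹ * ∑ i, ξ i ^ 2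

/-- Hilbert–Schmidt norm of the Hessian. -/
def hessNorm {d : ℕ} (v : EuclideanSpace ℝ (Fin d) → ℝ)
    (x : EuclideanSpace ℝ (Fin d)) : ℝ :=
  Real.sqrt (∑ i, ∑ j, pd2 i j v x ^ 2)

/-- Euclidean norm of the gradient. -/
def gradNorm {d : ℕ} (v : EuclideanSpace ℝ (Fin d) → ℝ)
    (x : EuclideanSpace ℝ (Fin d)) : ℝ :=
  Real.sqrt (∑ i, pd i v x ^ 2)

lemma pd_continuous {d : ℕ} {w : EuclideanSpace ℝ (Fin d) → ℝ} (hw : ContDiff ℝ 1 w) (i : Fin d) :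
    Continuous (pd i w) := by
  unfold pd
  exact (hw.continuous_fderiv one_ne_zero).clm_apply continuous_const

lemma pd_hasCompactSupport {d : ℕ} {w : EuclideanSpace ℝ (Fin d) → ℝ}
    (hc : HasCompactSupport w) (i : Fin d) : HasCompactSupport (pd i w) :=
  HasCompactSupport.fderiv_apply (𝕜 := ℝ) hc _

lemma pd_eq_zero {d : ℕ} {w : EuclideanSpace ℝ (Fin d) → ℝ} {x : EuclideanSpace ℝ (Fin d)}
    (hx : x ∉ tsupport w) (i : Fin d) : pd i w x = 0 := by
  have : fderiv ℝ w x = 0 := by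
    by_contra h
    exact hx (support_fderiv_subset ℝ (Function.mem_support.2 h))
  simp [pd, this]

/-- smooth approximation of `C¹` test functions -/
lemma approx_test {d : ℕ} {U : Set (EuclideanSpace ℝ (Fin d))} (hU : IsOpen U)
    {φ : EuclideanSpace ℝ (Fin d) → ℝ} (hφ : ContDiff ℝ 1 φ) (hc : HasCompactSupport φ)
    (hs : tsupport φ ⊆ U) {ε : ℝ} (hε : 0 < ε) :
    ∃ ψ : EuclideanSpace ℝ (Fin d) → ℝ, ContDiff ℝ (⊤ : ℕ∞) ψ ∧ HasCompactSupport ψ ∧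
      tsupport ψ ⊆ U ∧ ∀ x i, |pd i ψ x - pd i φ x| ≤ ε := by
  obtain ⟨δ₀, hδ₀, hK⟩ := hc.isCompact.exists_cthickening_subset_open hU hs
  have hcf : Continuous (fderiv ℝ φ) := hφ.continuous_fderiv one_ne_zero
  have huc : UniformContinuous (fderiv ℝ φ) :=
    (hc.fderiv (𝕜 := ℝ)).uniformContinuous_of_continuous hcf
  obtain ⟨δ₁, hδ₁, h1⟩ := Metric.uniformContinuous_iff.1 huc ε hε
  set r := min δ₀ δ₁ with hr
  have hr0 : 0 < r := lt_min hδ₀ hδ₁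
  let b : ContDiffBump (0 : EuclideanSpace ℝ (Fin d)) := ⟨r / 2, r, by positivity, by linarith⟩
  have hli : LocallyIntegrable (b.normed volume) volume := b.continuous_normed.locallyIntegrable
  refine ⟨convolution (b.normed volume) φ (ContinuousLinearMap.lsmul ℝ ℝ) volume, ?_, ?_, ?_, ?_⟩
  · exact b.hasCompactSupport_normed.contDiff_convolution_left _ b.contDiff_normed
      hφ.continuous.locallyIntegrable
  · exact b.hasCompactSupport_normed.convolution _ hc
  · refine subset_trans ?_ hK
    refine closure_minimal ?_ isClosed_cthickening
    refine (support_convolution_subset _).trans ?_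
    rintro x ⟨y, hy, z, hz, rfl⟩
    rw [b.support_normed_eq] at hy
    refine mem_cthickening_of_dist_le _ z _ _ (subset_tsupport _ hz) ?_
    have : ‖y‖ < r := by simpa using hy
    simp only [dist_eq_norm, add_sub_cancel_right]
    exact this.le.trans (min_le_left _ _)
  · intro x i
    have hd := hc.hasFDerivAt_convolution_right (ContinuousLinearMap.lsmul ℝ ℝ) hli hφ x
    have hL : (ContinuousLinearMap.lsmul ℝ ℝ : ℝ →L[ℝ] ℝ →L[ℝ] ℝ).precompR
        (EuclideanSpace ℝ (Fin d)) = ContinuousLinearMap.lsmul ℝ ℝ := by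
      ext; simp
    rw [hL] at hd
    have hdist := b.dist_normed_convolution_le (μ := volume) (x₀ := x) (ε := ε) (g := fderiv ℝ φ)
      hcf.aestronglyMeasurable (fun y hy => (h1 (lt_of_lt_of_le hy (min_le_right _ _))).le)
    unfold pd
    rw [hd.fderiv]
    rw [dist_eq_norm] at hdist
    rw [← ContinuousLinearMap.sub_apply, ← Real.norm_eq_abs]
    refine (ContinuousLinearMap.le_opNorm _ _).trans ?_
    simpa using hdist

/-- `∫ H · Dφ = 0` for all `C¹` test functions in `U`. -/
def WeakDiv {d : ℕ} (H : Fin d → EuclideanSpace ℝ (Fin d) → ℝ)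
    (U : Set (EuclideanSpace ℝ (Fin d))) : Prop :=
  ∀ φ : EuclideanSpace ℝ (Fin d) → ℝ, ContDiff ℝ 1 φ → HasCompactSupport φ → tsupport φ ⊆ U →
    ∫ x, ∑ i, H i x * pd i φ x = 0

lemma integrable_mul_pd {d : ℕ} {H : EuclideanSpace ℝ (Fin d) → ℝ} (hH : Integrable H)
    {φ : EuclideanSpace ℝ (Fin d) → ℝ} (hφ : ContDiff ℝ 1 φ) (hc : HasCompactSupport φ)
    (i : Fin d) : Integrable (fun x => H x * pd i φ x) := by
  obtain ⟨C, hC⟩ := (pd_hasCompactSupport hc i).exists_bound_of_continuous (pd_continuous hφ i)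
  exact hH.mul_bdd (c := C) (pd_continuous hφ i).aestronglyMeasurable (Eventually.of_forall hC)

lemma weakDiv_of_smooth {d : ℕ} {H : Fin d → EuclideanSpace ℝ (Fin d) → ℝ}
    {U : Set (EuclideanSpace ℝ (Fin d))} (hU : IsOpen U) (hH : ∀ i, Integrable (H i))
    (h : ∀ φ : EuclideanSpace ℝ (Fin d) → ℝ, ContDiff ℝ (⊤ : ℕ∞) φ → HasCompactSupport φ →
      tsupport φ ⊆ U → ∫ x, ∑ i, H i x * pd i φ x = 0) : WeakDiv H U := by
  intro φ hφ hc hs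
  have hInt : ∀ ψ : EuclideanSpace ℝ (Fin d) → ℝ, ContDiff ℝ 1 ψ → HasCompactSupport ψ →
      Integrable (fun x => ∑ i, H i x * pd i ψ x) := fun ψ h1 h2 =>
    integrable_finsetSum _ fun i _ => integrable_mul_pd (hH i) h1 h2 i
  have key : ∀ ε : ℝ, 0 < ε → |∫ x, ∑ i, H i x * pd i φ x| ≤ ε * ∫ x, ∑ i, |H i x| := by
    intro ε hε
    obtain ⟨ψ, h1, h2, h3, h4⟩ := approx_test hU hφ hc hs hε
    have h1' : ContDiff ℝ 1 ψ := h1.of_le (by exact_mod_cast le_top)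
    have e : ∫ x, ∑ i, H i x * pd i φ x
        = ∫ x, ((∑ i, H i x * pd i φ x) - ∑ i, H i x * pd i ψ x) := by
      rw [integral_sub (hInt _ hφ hc) (hInt _ h1' h2), h ψ h1 h2 h3, sub_zero]
    rw [e, ← integral_const_mul, ← Real.norm_eq_abs]
    refine norm_integral_le_of_norm_le ?_ (Eventually.of_forall fun x => ?_)
    · exact (integrable_finsetSum _ fun i _ => (hH i).abs).const_mul _
    · rw [← Finset.sum_sub_distrib, Finset.mul_sum]
      refine (norm_sum_le _ _).trans (Finset.sum_le_sum fun i _ => ?_)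
      rw [← mul_sub, Real.norm_eq_abs, abs_mul, mul_comm, abs_sub_comm]
      exact mul_le_mul_of_nonneg_right (h4 x i) (abs_nonneg _)
  have hl : Tendsto (fun ε : ℝ => ε * ∫ x, ∑ i, |H i x|) (nhdsWithin 0 (Ioi 0)) (nhds 0) := by
    have : Tendsto (fun ε : ℝ => ε * ∫ x, ∑ i, |H i x|) (nhds 0)
        (nhds (0 * ∫ x, ∑ i, |H i x|)) := (continuous_id.mul continuous_const).tendsto 0
    rw [zero_mul] at this
    exact this.mono_left nhdsWithin_le_nhds
  have := ge_of_tendsto hl (eventually_nhdsWithin_of_forall (fun ε hε => key ε hε))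
  exact abs_nonpos_iff.1 this

lemma pd_comp_add {d : ℕ} (w : EuclideanSpace ℝ (Fin d) → ℝ) (h x : EuclideanSpace ℝ (Fin d))
    (i : Fin d) : pd i (fun y => w (y + h)) x = pd i w (x + h) := by
  simp [pd, fderiv_comp_add_right]

lemma tsupport_shift {d : ℕ} (w : EuclideanSpace ℝ (Fin d) → ℝ) (h : EuclideanSpace ℝ (Fin d)) :
    tsupport (fun y => w (y + h)) = (fun y => y + h) ⁻¹' tsupport w :=
  tsupport_comp_eq_preimage w (Homeomorph.addRight h)

lemma hasCompactSupport_shift {d : ℕ} {w : EuclideanSpace ℝ (Fin d) → ℝ}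
    (hw : HasCompactSupport w) (h : EuclideanSpace ℝ (Fin d)) :
    HasCompactSupport (fun y => w (y + h)) :=
  hw.comp_homeomorph (Homeomorph.addRight h)

lemma contDiff_shift {d : ℕ} {w : EuclideanSpace ℝ (Fin d) → ℝ}
    (hw : ContDiff ℝ 1 w) (h : EuclideanSpace ℝ (Fin d)) :
    ContDiff ℝ 1 (fun y => w (y + h)) := hw.comp (contDiff_id.add contDiff_const)

lemma WeakDiv.shift {d : ℕ} {H : Fin d → EuclideanSpace ℝ (Fin d) → ℝ}
    {U : Set (EuclideanSpace ℝ (Fin d))} (hW : WeakDiv H U) (h : EuclideanSpace ℝ (Fin d)) :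
    WeakDiv (fun i x => H i (x + h)) ((fun x => x + h) ⁻¹' U) := by
  intro φ hφ hc hs
  have := hW (fun y => φ (y + -h)) (contDiff_shift hφ _) (hasCompactSupport_shift hc _) (by
    rw [tsupport_shift]
    intro y hy
    have := hs hy
    simpa using this)
  rw [← integral_add_right_eq_self _ h] at this
  simpa [pd_comp_add] using this

/-- squared length of the gradient -/
def gsq {d : ℕ} (w : EuclideanSpace ℝ (Fin d) → ℝ) (x : EuclideanSpace ℝ (Fin d)) : ℝ :=
  ∑ i, pd i w x ^ 2

lemma gsq_nonneg {d : ℕ} (w : EuclideanSpace ℝ (Fin d) → ℝ) (x : EuclideanSpace ℝ (Fin d)) :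
    0 ≤ gsq w x := Finset.sum_nonneg fun _ _ => sq_nonneg _

lemma gsq_continuous {d : ℕ} {w : EuclideanSpace ℝ (Fin d) → ℝ} (hw : ContDiff ℝ 1 w) :
    Continuous (gsq w) := by
  unfold gsq
  exact continuous_finsetSum _ fun i _ => (pd_continuous hw i).pow 2

lemma fderiv_apply_eq {d : ℕ} (L : EuclideanSpace ℝ (Fin d) →L[ℝ] ℝ)
    (v : EuclideanSpace ℝ (Fin d)) : L v = ∑ i, v i * L (EuclideanSpace.single i 1) := by
  have h : v = ∑ i, v i • EuclideanSpace.single i (1 : ℝ) := by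
    ext j
    simp [Pi.single_apply]
  conv_lhs => rw [h]
  simp [map_sum]

lemma norm_fderiv_sq_le {d : ℕ} (w : EuclideanSpace ℝ (Fin d) → ℝ)
    (x : EuclideanSpace ℝ (Fin d)) : ‖fderiv ℝ w x‖ ^ 2 ≤ gsq w x := by
  have h : ‖fderiv ℝ w x‖ ≤ Real.sqrt (gsq w x) := by
    refine ContinuousLinearMap.opNorm_le_bound _ (Real.sqrt_nonneg _) fun v => ?_
    rw [Real.norm_eq_abs]
    refine Real.abs_le_sqrt ?_ |>.trans (b := Real.sqrt (gsq w x * ‖v‖ ^ 2)) ?_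
    · rw [fderiv_apply_eq, EuclideanSpace.norm_sq_eq, mul_comm]
      simpa [gsq, pd] using Finset.sum_mul_sq_le_sq_mul_sq Finset.univ (fun i => v i)
        (fun i => fderiv ℝ w x (EuclideanSpace.single i 1))
    · rw [Real.sqrt_mul (gsq_nonneg _ _), Real.sqrt_sq (norm_nonneg _)]
  calc _ ≤ (Real.sqrt (gsq w x)) ^ 2 := by gcongr
    _ = _ := Real.sq_sqrt (gsq_nonneg _ _)

/-- ellipticity assumptions -/
structure Ell {d : ℕ} (ν : ℝ) (a : Fin d → Fin d → EuclideanSpace ℝ (Fin d) → ℝ) : Prop where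
  pos : 0 < ν
  meas : ∀ i j, Measurable (a i j)
  coer : ∀ (x : EuclideanSpace ℝ (Fin d)) (ξ : Fin d → ℝ),
          ν * ∑ i, ξ i ^ 2 ≤ ∑ i, ∑ j, a i j x * ξ i * ξ j
  bdd : ∀ x : EuclideanSpace ℝ (Fin d), ∑ i, ∑ j, a i j x ^ 2 ≤ ν⁻¹ ^ 2

/-- weak solution package -/
structure Sol {d : ℕ} (a : Fin d → Fin d → EuclideanSpace ℝ (Fin d) → ℝ)
    (w : EuclideanSpace ℝ (Fin d) → ℝ) (g : Fin d → EuclideanSpace ℝ (Fin d) → ℝ)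
    (G : ℝ) (x0 : EuclideanSpace ℝ (Fin d)) (R : ℝ) : Prop where
  hw : ContDiff ℝ 1 w
  hc : HasCompactSupport w
  hg : ∀ i, Integrable (g i)
  hG : ∀ x ∈ ball x0 R, ∑ i, g i x ^ 2 ≤ G ^ 2
  hE : WeakDiv (fun i x => (∑ j, a i j x * pd j w x) - g i x) (ball x0 R)

lemma Ell.abs_le {d : ℕ} {ν : ℝ} {a : Fin d → Fin d → EuclideanSpace ℝ (Fin d) → ℝ}
    (h : Ell ν a) (i j : Fin d) (x : EuclideanSpace ℝ (Fin d)) : |a i j x| ≤ ν⁻¹ := by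
  have := h.bdd x
  have h1 : a i j x ^ 2 ≤ ∑ j, a i j x ^ 2 :=
    Finset.single_le_sum (f := fun j => a i j x ^ 2) (fun _ _ => sq_nonneg _) (Finset.mem_univ j)
  have h2 : ∑ j, a i j x ^ 2 ≤ ∑ i, ∑ j, a i j x ^ 2 :=
    Finset.single_le_sum (f := fun i => ∑ j, a i j x ^ 2)
      (fun _ _ => Finset.sum_nonneg fun _ _ => sq_nonneg _) (Finset.mem_univ i)
  exact abs_le_of_sq_le_sq (by linarith) (inv_nonneg.2 h.pos.le)

lemma Ell.integrable_flux {d : ℕ} {ν : ℝ} {a : Fin d → Fin d → EuclideanSpace ℝ (Fin d) → ℝ}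
    (h : Ell ν a) {w : EuclideanSpace ℝ (Fin d) → ℝ} (hw : ContDiff ℝ 1 w)
    (hc : HasCompactSupport w) (i : Fin d) : Integrable (fun x => ∑ j, a i j x * pd j w x) :=
  integrable_finsetSum _ fun j _ =>
    (((pd_continuous hw j).integrable_of_hasCompactSupport (pd_hasCompactSupport hc j)).bdd_mul
      (c := ν⁻¹) (h.meas i j).aestronglyMeasurable
      (Eventually.of_forall fun x => by simpa using h.abs_le i j x))

lemma abs_le_amgm {X A B : ℝ} (hA : 0 ≤ A) (hB : 0 ≤ B) (h : X ^ 2 ≤ A * B) :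
    |X| ≤ (A + B) / 2 := by
  apply abs_le_of_sq_le_sq _ (by linarith)
  nlinarith [sq_nonneg (A - B)]

lemma energy_pointwise {d : ℕ} {ν : ℝ} {a : Fin d → Fin d → EuclideanSpace ℝ (Fin d) → ℝ}
    (h : Ell ν a) (x : EuclideanSpace ℝ (Fin d)) (ξ ζ γ : Fin d → ℝ) {η w z zb θ β ρ : ℝ}
    (hw : w ^ 2 ≤ z) (hzb : 0 ≤ zb) (hθ1 : zb ≤ θ) (hθ2 : θ ≤ (1 + 2 * β) * zb)
    (hβ : 0 ≤ β) (hγ : ∑ i, γ i ^ 2 ≤ ρ ^ 2 * z) :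
    ν / 2 * (η ^ 2 * zb * ∑ i, ξ i ^ 2) - (4 * ν⁻¹ ^ 3 + ν⁻¹ + 1) * (1 + 2 * β) *
      (zb * z * (∑ i, ζ i ^ 2 + ρ ^ 2 * η ^ 2)) ≤
    ∑ i, ((∑ j, a i j x * ξ j) - γ i) * (2 * η * ζ i * (w * zb) + η ^ 2 * (θ * ξ i)) := by
  set P := ∑ i, ξ i ^ 2 with hP
  set Q := ∑ i, ζ i ^ 2 with hQ
  have hP0 : 0 ≤ P := Finset.sum_nonneg fun _ _ => sq_nonneg _
  have hQ0 : 0 ≤ Q := Finset.sum_nonneg fun _ _ => sq_nonneg _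
  have hz0 : 0 ≤ z := (sq_nonneg w).trans hw
  have hν := h.pos
  have hμ : 0 < ν⁻¹ := inv_pos.2 hν
  set X1 := ∑ i, (∑ j, a i j x * ξ j) * ξ i with hX1
  set X2 := ∑ i, (∑ j, a i j x * ξ j) * ζ i with hX2
  set X3 := ∑ i, γ i * ζ i with hX3
  set X4 := ∑ i, γ i * ξ i with hX4
  have e : ∑ i, ((∑ j, a i j x * ξ j) - γ i) * (2 * η * ζ i * (w * zb) + η ^ 2 * (θ * ξ i))
      = η ^ 2 * θ * X1 + zb * (2 * η * w * X2) - zb * (2 * η * w * X3) - η ^ 2 * θ * X4 := by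
    simp only [hX1, hX2, hX3, hX4, Finset.mul_sum (s := Finset.univ) (a := η ^ 2 * θ),
      Finset.mul_sum (s := Finset.univ) (a := 2 * η * w),
      Finset.mul_sum (s := Finset.univ) (a := zb)]
    rw [← Finset.sum_add_distrib, ← Finset.sum_sub_distrib, ← Finset.sum_sub_distrib]
    exact Finset.sum_congr rfl fun i _ => by ring
  have b1 : ν * P ≤ X1 := by
    refine (h.coer x ξ).trans (le_of_eq ?_)
    simp only [hX1, Finset.sum_mul]
    exact Finset.sum_congr rfl fun i _ => Finset.sum_congr rfl fun j _ => by ring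
  have b2 : X2 ^ 2 ≤ ν⁻¹ ^ 2 * P * Q := by
    refine (Finset.sum_mul_sq_le_sq_mul_sq _ _ _).trans ?_
    refine mul_le_mul_of_nonneg_right ?_ hQ0
    calc ∑ i, (∑ j, a i j x * ξ j) ^ 2 ≤ ∑ i, (∑ j, a i j x ^ 2) * P :=
          Finset.sum_le_sum fun i _ => Finset.sum_mul_sq_le_sq_mul_sq _ _ _
      _ = (∑ i, ∑ j, a i j x ^ 2) * P := by rw [Finset.sum_mul]
      _ ≤ _ := mul_le_mul_of_nonneg_right (h.bdd x) hP0
  have b3 : X3 ^ 2 ≤ ρ ^ 2 * z * Q :=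
    (Finset.sum_mul_sq_le_sq_mul_sq _ _ _).trans (mul_le_mul_of_nonneg_right hγ hQ0)
  have b4 : X4 ^ 2 ≤ ρ ^ 2 * z * P :=
    (Finset.sum_mul_sq_le_sq_mul_sq _ _ _).trans (mul_le_mul_of_nonneg_right hγ hP0)
  have hνμ : ν * ν⁻¹ = 1 := mul_inv_cancel₀ hν.ne'
  have c2 : |2 * η * w * X2| ≤ (ν / 2 * (η ^ 2 * P) + 8 * ν⁻¹ ^ 3 * (z * Q)) / 2 := by
    apply abs_le_amgm (by positivity) (by positivity)
    calc (2 * η * w * X2) ^ 2 = 4 * η ^ 2 * (w ^ 2 * X2 ^ 2) := by ring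
      _ ≤ 4 * η ^ 2 * (z * (ν⁻¹ ^ 2 * P * Q)) := by gcongr
      _ = (ν * ν⁻¹) * (4 * η ^ 2 * (z * (ν⁻¹ ^ 2 * P * Q))) := by rw [hνμ, one_mul]
      _ = _ := by ring
  have c3 : |2 * η * w * X3| ≤ (2 * (ρ ^ 2 * η ^ 2 * z) + 2 * (z * Q)) / 2 := by
    apply abs_le_amgm (by positivity) (by positivity)
    calc (2 * η * w * X3) ^ 2 = 4 * η ^ 2 * (w ^ 2 * X3 ^ 2) := by ring
      _ ≤ 4 * η ^ 2 * (z * (ρ ^ 2 * z * Q)) := by gcongr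
      _ = _ := by ring
  have c4 : |X4| ≤ (ν / 2 * P + 2 * ν⁻¹ * (ρ ^ 2 * z)) / 2 := by
    apply abs_le_amgm (by positivity) (by positivity)
    calc X4 ^ 2 ≤ ρ ^ 2 * z * P := b4
      _ = (ν * ν⁻¹) * (ρ ^ 2 * z * P) := by rw [hνμ, one_mul]
      _ = _ := by ring
  rw [e]
  have hθ0 : 0 ≤ θ := hzb.trans hθ1
  have d1 : η ^ 2 * θ * (ν * P) ≤ η ^ 2 * θ * X1 := by gcongr
  have d2 := mul_le_mul_of_nonneg_left ((abs_le.1 c2).1) hzb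
  have d3 := mul_le_mul_of_nonneg_left ((abs_le.1 c3).2) hzb
  have d4 := mul_le_mul_of_nonneg_left ((abs_le.1 c4).2) (by positivity : 0 ≤ η ^ 2 * θ)
  have d5 : zb * (3 * ν / 4 * (η ^ 2 * P)) ≤ θ * (3 * ν / 4 * (η ^ 2 * P)) :=
    mul_le_mul_of_nonneg_right hθ1 (by positivity)
  have d6 : θ * (ν⁻¹ * (η ^ 2 * (ρ ^ 2 * z))) ≤ (1 + 2 * β) * zb * (ν⁻¹ * (η ^ 2 * (ρ ^ 2 * z))) :=
    mul_le_mul_of_nonneg_right hθ2 (by positivity)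
  have n1 : 0 ≤ zb * z * Q := by positivity
  have n2 : 0 ≤ zb * z * (ρ ^ 2 * η ^ 2) := by positivity
  have n3 : 0 ≤ 2 * β * ((4 * ν⁻¹ ^ 3 + 1) * (zb * z * Q)) := by positivity
  have n4 : 0 ≤ 2 * β * (zb * z * (ρ ^ 2 * η ^ 2)) := by positivity
  have n5 : 0 ≤ (1 + 2 * β) * (4 * ν⁻¹ ^ 3) * (zb * z * (ρ ^ 2 * η ^ 2)) := by positivity
  have n6 : 0 ≤ (1 + 2 * β) * ν⁻¹ * (zb * z * Q) := by positivity
  linarith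

lemma pd_test {d : ℕ} {w η : EuclideanSpace ℝ (Fin d) → ℝ} (hw : ContDiff ℝ 1 w)
    (hη : ContDiff ℝ 1 η) {κ : ℝ} (hκ : 0 < κ) (β : ℝ) (x : EuclideanSpace ℝ (Fin d)) (i : Fin d) :
    pd i (fun x => η x ^ 2 * (w x * (w x ^ 2 + κ) ^ β)) x =
      2 * η x * pd i η x * (w x * (w x ^ 2 + κ) ^ β) +
      η x ^ 2 * (((w x ^ 2 + κ) ^ β + 2 * β * w x ^ 2 * (w x ^ 2 + κ) ^ (β - 1)) * pd i w x) := by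
  have h1 := (hw.differentiable one_ne_zero x).hasFDerivAt
  have h2 := (hη.differentiable one_ne_zero x).hasFDerivAt
  have hz : w x ^ 2 + κ ≠ 0 := by positivity
  have h3 := (((h1.pow 2).add_const κ).rpow_const (p := β) (Or.inl hz))
  have h4 := (h2.pow 2).mul (h1.mul h3)
  unfold pd
  have := h4.fderiv
  simp only [Pi.mul_def] at this
  rw [this]
  simp
  ring

lemma test_contDiff {d : ℕ} {w η : EuclideanSpace ℝ (Fin d) → ℝ} (hw : ContDiff ℝ 1 w)
    (hη : ContDiff ℝ 1 η) {κ : ℝ} (hκ : 0 < κ) (β : ℝ) :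
    ContDiff ℝ 1 (fun x => η x ^ 2 * (w x * (w x ^ 2 + κ) ^ β)) :=
  (hη.pow 2).mul (hw.mul (((hw.pow 2).add contDiff_const).rpow_const_of_ne
    fun x => (add_pos_of_nonneg_of_pos (sq_nonneg (w x)) hκ).ne'))

lemma z_rpow_continuous {d : ℕ} {w : EuclideanSpace ℝ (Fin d) → ℝ} (hw : ContDiff ℝ 1 w)
    {κ : ℝ} (hκ : 0 < κ) (β : ℝ) : Continuous (fun x => (w x ^ 2 + κ) ^ β) :=
  ((hw.continuous.pow 2).add continuous_const).rpow_const
    fun x => Or.inl (add_pos_of_nonneg_of_pos (sq_nonneg (w x)) hκ).ne'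

lemma tsupport_sq_mul {d : ℕ} {η f : EuclideanSpace ℝ (Fin d) → ℝ} :
    tsupport (fun x => η x ^ 2 * f x) ⊆ tsupport η := by
  apply closure_mono
  intro x hx
  simp only [Function.mem_support] at hx ⊢
  intro h0; simp [h0] at hx

lemma gsq_hasCompactSupport {d : ℕ} {η : EuclideanSpace ℝ (Fin d) → ℝ} (hc : HasCompactSupport η) :
    HasCompactSupport (gsq η) :=
  HasCompactSupport.intro hc.isCompact fun x hx => by simp [gsq, pd_eq_zero hx]

/-- the weight appearing on the right side of the energy inequality is integrable -/
lemma rhs_integrable {d : ℕ} {w η : EuclideanSpace ℝ (Fin d) → ℝ} (hw : ContDiff ℝ 1 w)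
    (hη : ContDiff ℝ 1 η) (hηc : HasCompactSupport η) {κ : ℝ} (hκ : 0 < κ) (β ρ : ℝ) :
    Integrable (fun x => (w x ^ 2 + κ) ^ β * (gsq η x + ρ ^ 2 * η x ^ 2)) := by
  refine Continuous.integrable_of_hasCompactSupport ?_ ?_
  · exact (z_rpow_continuous hw hκ β).mul
      ((gsq_continuous hη).add (continuous_const.mul (hη.continuous.pow 2)))
  · refine HasCompactSupport.intro hηc.isCompact fun x hx => ?_
    simp [gsq, pd_eq_zero hx, image_eq_zero_of_notMem_tsupport hx]

lemma lhs_integrable {d : ℕ} {w η : EuclideanSpace ℝ (Fin d) → ℝ} (hw : ContDiff ℝ 1 w)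
    (hη : ContDiff ℝ 1 η) (hηc : HasCompactSupport η) {κ : ℝ} (hκ : 0 < κ) (β : ℝ) :
    Integrable (fun x => η x ^ 2 * (w x ^ 2 + κ) ^ β * gsq w x) := by
  refine Continuous.integrable_of_hasCompactSupport ?_ ?_
  · exact ((hη.continuous.pow 2).mul (z_rpow_continuous hw hκ β)).mul (gsq_continuous hw)
  · refine HasCompactSupport.intro hηc.isCompact fun x hx => ?_
    simp [image_eq_zero_of_notMem_tsupport hx]

/-- energy (Caccioppoli) inequality with powers -/
lemma caccioppoli {d : ℕ} {ν : ℝ} {a : Fin d → Fin d → EuclideanSpace ℝ (Fin d) → ℝ}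
    (h : Ell ν a) {w : EuclideanSpace ℝ (Fin d) → ℝ} {g : Fin d → EuclideanSpace ℝ (Fin d) → ℝ}
    {G : ℝ} {x0 : EuclideanSpace ℝ (Fin d)} {R : ℝ} (hS : Sol a w g G x0 R)
    {η : EuclideanSpace ℝ (Fin d) → ℝ} (hη : ContDiff ℝ 1 η) (hηc : HasCompactSupport η)
    (hηs : tsupport η ⊆ ball x0 R) {κ ρ β : ℝ} (hκ : 0 < κ) (hGκ : G ^ 2 ≤ ρ ^ 2 * κ)
    (hβ : 0 ≤ β) :
    ∫ x, η x ^ 2 * (w x ^ 2 + κ) ^ β * gsq w x ≤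
      2 * ν⁻¹ * (4 * ν⁻¹ ^ 3 + ν⁻¹ + 1) * (1 + 2 * β) *
        ∫ x, (w x ^ 2 + κ) ^ (β + 1) * (gsq η x + ρ ^ 2 * η x ^ 2) := by
  have hw := hS.hw
  have hν := h.pos
  set φ : EuclideanSpace ℝ (Fin d) → ℝ := fun x => η x ^ 2 * (w x * (w x ^ 2 + κ) ^ β) with hφ
  have hφ1 : ContDiff ℝ 1 φ := test_contDiff hw hη hκ β
  have hts : tsupport φ ⊆ tsupport η := tsupport_sq_mul
  have hφc : HasCompactSupport φ := hηc.of_isClosed_subset (isClosed_tsupport _) hts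
  have hz := hS.hE φ hφ1 hφc (hts.trans hηs)
  have hInt : Integrable (fun x => ∑ i, ((∑ j, a i j x * pd j w x) - g i x) * pd i φ x) :=
    integrable_finsetSum _ fun i _ =>
      integrable_mul_pd ((h.integrable_flux hw hS.hc i).sub (hS.hg i)) hφ1 hφc i
  have hL := lhs_integrable hw hη hηc hκ β
  have hRR := rhs_integrable hw hη hηc hκ (β + 1) ρ
  set C := (4 * ν⁻¹ ^ 3 + ν⁻¹ + 1) with hC
  have hmono := integral_mono ((hL.const_mul (ν / 2)).sub (hRR.const_mul (C * (1 + 2 * β)))) hInt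
    (fun x => by
      by_cases hx : x ∈ tsupport η
      · have hxb := hηs hx
        have hzpos : 0 < w x ^ 2 + κ := by positivity
        have hmul : (w x ^ 2 + κ) ^ (β + 1) = (w x ^ 2 + κ) ^ β * (w x ^ 2 + κ) := by
          rw [Real.rpow_add hzpos, Real.rpow_one]
        have hmul' : (w x ^ 2 + κ) ^ (β - 1) * (w x ^ 2 + κ) = (w x ^ 2 + κ) ^ β := by
          rw [← Real.rpow_add_one hzpos.ne', sub_add_cancel]
        have hp0 : 0 < (w x ^ 2 + κ) ^ (β - 1) := Real.rpow_pos_of_pos hzpos _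
        have := energy_pointwise h x (fun i => pd i w x) (fun i => pd i η x) (fun i => g i x)
          (η := η x) (w := w x) (z := w x ^ 2 + κ) (zb := (w x ^ 2 + κ) ^ β)
          (θ := (w x ^ 2 + κ) ^ β + 2 * β * w x ^ 2 * (w x ^ 2 + κ) ^ (β - 1)) (β := β) (ρ := ρ)
          (by linarith) (Real.rpow_nonneg hzpos.le _) (by
            have : 0 ≤ 2 * β * w x ^ 2 * (w x ^ 2 + κ) ^ (β - 1) := by positivity
            linarith) (by
            have : 0 ≤ 2 * β * κ * (w x ^ 2 + κ) ^ (β - 1) := by positivity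
            nlinarith) hβ (by
            refine (hS.hG x hxb).trans (hGκ.trans ?_)
            have : 0 ≤ ρ ^ 2 * w x ^ 2 := by positivity
            linarith)
        simp only [hφ, pd_test hw hη hκ β x, Pi.sub_apply]
        rw [hmul]
        exact this
      · have h0 : η x = 0 := image_eq_zero_of_notMem_tsupport hx
        have h1 : ∀ i, pd i η x = 0 := pd_eq_zero hx
        have h2 : ∀ i, pd i φ x = 0 := pd_eq_zero (fun h => hx (hts h))
        simp [h0, h1, h2, gsq])
  rw [hz] at hmono
  simp only [Pi.sub_apply] at hmono
  rw [integral_sub (hL.const_mul _) (hRR.const_mul _), integral_const_mul, integral_const_mul] at hmono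
  set I := ∫ x, η x ^ 2 * (w x ^ 2 + κ) ^ β * gsq w x
  set J := ∫ x, (w x ^ 2 + κ) ^ (β + 1) * (gsq η x + ρ ^ 2 * η x ^ 2)
  have h1 : ν / 2 * I ≤ C * (1 + 2 * β) * J := by linarith
  calc I = 2 * ν⁻¹ * (ν / 2 * I) := by field_simp
    _ ≤ 2 * ν⁻¹ * (C * (1 + 2 * β) * J) := by gcongr
    _ = _ := by ring

lemma hasDerivAt_maxsq (t : ℝ) : HasDerivAt (fun t : ℝ => (max 0 t) ^ 2) (2 * max 0 t) t := by
  rcases lt_trichotomy t 0 with h | h | h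
  · rw [max_eq_left h.le, mul_zero]
    refine (hasDerivAt_const t (0 : ℝ)).congr_of_eventuallyEq ?_
    filter_upwards [Iio_mem_nhds h] with s hs
    rw [max_eq_left (le_of_lt hs)]; simp
  · subst h
    simp only [max_self, mul_zero]
    rw [hasDerivAt_iff_isLittleO]
    simp only [max_self, sub_zero, smul_zero]
    rw [Asymptotics.isLittleO_iff]
    intro c hc
    filter_upwards [Metric.ball_mem_nhds (0 : ℝ) hc] with s hs
    have hs' : |s| < c := by simpa using hs
    have h1 : max 0 s ≤ |s| := max_le (abs_nonneg _) (le_abs_self _)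
    have h0 : 0 ≤ max 0 s := le_max_left _ _
    simp only [Real.norm_eq_abs]
    rw [abs_of_nonneg (by simp)]
    have : (max 0 s) ^ 2 ≤ c * |s| := by
      rw [sq]; exact mul_le_mul (h1.trans hs'.le) h1 h0 hc.le
    simpa using this
  · rw [max_eq_right h.le]
    have := hasDerivAt_pow 2 t
    simp only [Nat.cast_ofNat, Nat.add_one_sub_one, pow_one] at this
    refine this.congr_of_eventuallyEq ?_
    filter_upwards [Ioi_mem_nhds h] with s hs
    rw [max_eq_right (le_of_lt hs)]

lemma contDiff_maxsq : ContDiff ℝ 1 (fun t : ℝ => (max 0 t) ^ 2) := by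
  rw [contDiff_one_iff_deriv]
  refine ⟨fun t => (hasDerivAt_maxsq t).differentiableAt, ?_⟩
  have : deriv (fun t : ℝ => (max 0 t) ^ 2) = fun t => 2 * max 0 t :=
    funext fun t => (hasDerivAt_maxsq t).deriv
  rw [this]
  fun_prop

/-- explicit `C¹` cutoff -/
def cut {d : ℕ} (x0 : EuclideanSpace ℝ (Fin d)) (r s : ℝ) (x : EuclideanSpace ℝ (Fin d)) : ℝ :=
  (max 0 ((s ^ 2 - ‖x - x0‖ ^ 2) / (s ^ 2 - r ^ 2))) ^ 2

lemma cut_contDiff {d : ℕ} (x0 : EuclideanSpace ℝ (Fin d)) (r s : ℝ) :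
    ContDiff ℝ 1 (cut x0 r s) := by
  unfold cut
  refine contDiff_maxsq.comp (ContDiff.div_const (contDiff_const.sub ?_) _)
  exact (contDiff_id.sub contDiff_const).norm_sq ℝ

lemma cut_hasFDerivAt {d : ℕ} (x0 : EuclideanSpace ℝ (Fin d)) (r s : ℝ)
    (x : EuclideanSpace ℝ (Fin d)) (i : Fin d) :
    pd i (cut x0 r s) x = 2 * max 0 ((s ^ 2 - ‖x - x0‖ ^ 2) / (s ^ 2 - r ^ 2)) *
      (-(2 * (x i - x0 i)) / (s ^ 2 - r ^ 2)) := by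
  have h1 : HasFDerivAt (fun y : EuclideanSpace ℝ (Fin d) => ‖y - x0‖ ^ 2)
      (2 • (innerSL ℝ (x - x0))) x := by
    have := (hasStrictFDerivAt_norm_sq (x - x0)).hasFDerivAt.comp x ((hasFDerivAt_id x).sub_const x0)
    rw [ContinuousLinearMap.comp_id] at this
    exact this
  have h2 := (hasDerivAt_maxsq ((s ^ 2 - ‖x - x0‖ ^ 2) / (s ^ 2 - r ^ 2))).comp_hasFDerivAt x
    ((h1.const_sub (s ^ 2)).mul_const (s ^ 2 - r ^ 2)⁻¹)
  have h3 : HasFDerivAt (cut x0 r s) _ x := h2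
  unfold pd
  rw [h3.fderiv]
  simp [EuclideanSpace.inner_single_right]
  ring_nf

lemma cut_zero {d : ℕ} {x0 : EuclideanSpace ℝ (Fin d)} {r s : ℝ} (hr : 0 ≤ r) (hrs : r < s)
    {x : EuclideanSpace ℝ (Fin d)} (hx : x ∉ ball x0 s) :
    max 0 ((s ^ 2 - ‖x - x0‖ ^ 2) / (s ^ 2 - r ^ 2)) = 0 := by
  apply max_eq_left
  apply div_nonpos_of_nonpos_of_nonneg
  · have : s ≤ ‖x - x0‖ := by simpa [dist_eq_norm] using hx
    nlinarith
  · nlinarith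

lemma cut_tsupport {d : ℕ} {x0 : EuclideanSpace ℝ (Fin d)} {r s : ℝ} (hr : 0 ≤ r) (hrs : r < s) :
    tsupport (cut x0 r s) ⊆ closedBall x0 s := by
  refine closure_minimal ?_ isClosed_closedBall
  intro x hx
  by_contra h
  have h' : x ∉ ball x0 s := fun h' => h (ball_subset_closedBall h')
  exact hx (by simp [cut, cut_zero hr hrs h'])

lemma cut_hasCompactSupport {d : ℕ} {x0 : EuclideanSpace ℝ (Fin d)} {r s : ℝ} (hr : 0 ≤ r)
    (hrs : r < s) : HasCompactSupport (cut x0 r s) :=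
  (isCompact_closedBall x0 s).of_isClosed_subset (isClosed_tsupport _) (cut_tsupport hr hrs)

lemma cut_nonneg {d : ℕ} (x0 : EuclideanSpace ℝ (Fin d)) (r s : ℝ)
    (x : EuclideanSpace ℝ (Fin d)) : 0 ≤ cut x0 r s x := sq_nonneg _

lemma cut_ge_one {d : ℕ} {x0 : EuclideanSpace ℝ (Fin d)} {r s : ℝ} (hr : 0 ≤ r) (hrs : r < s)
    {x : EuclideanSpace ℝ (Fin d)} (hx : x ∈ ball x0 r) : 1 ≤ cut x0 r s x := by
  have hx' : ‖x - x0‖ < r := by simpa [dist_eq_norm] using hx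
  have h1 : 1 ≤ (s ^ 2 - ‖x - x0‖ ^ 2) / (s ^ 2 - r ^ 2) := by
    rw [one_le_div (by nlinarith)]
    nlinarith [norm_nonneg (x - x0)]
  have h2 : 1 ≤ max 0 ((s ^ 2 - ‖x - x0‖ ^ 2) / (s ^ 2 - r ^ 2)) := h1.trans (le_max_right _ _)
  unfold cut
  nlinarith

/-- bound of the cutoff weight; `T` bounds `R / (s - r)`, `ρ = 1 / R` -/
lemma cut_bound {d : ℕ} {x0 : EuclideanSpace ℝ (Fin d)} {r s ρ T : ℝ} (hr : 0 ≤ r) (hrs : r < s)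
    (hρ : 0 < ρ) (hs : ρ * s ≤ 1) (hT : 1 ≤ T * (ρ * (s - r))) (x : EuclideanSpace ℝ (Fin d)) :
    gsq (cut x0 r s) x + ρ ^ 2 * cut x0 r s x ^ 2 ≤
      (ball x0 s).indicator (fun _ => 17 * ρ ^ 2 * T ^ 4) x := by
  by_cases hx : x ∈ ball x0 s
  · rw [indicator_of_mem hx]
    have hx' : ‖x - x0‖ < s := by simpa [dist_eq_norm] using hx
    set m := max 0 ((s ^ 2 - ‖x - x0‖ ^ 2) / (s ^ 2 - r ^ 2)) with hm
    have hsr : 0 < s - r := by linarith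
    have hs0 : 0 < s := by linarith
    have hD : 0 < s ^ 2 - r ^ 2 := by nlinarith
    have hT0 : 0 < T := by
      by_contra h
      push Not at h
      have : T * (ρ * (s - r)) ≤ 0 := mul_nonpos_of_nonpos_of_nonneg h (by positivity)
      linarith
    have hm0 : 0 ≤ m := le_max_left _ _
    have hmT : m ≤ T := by
      apply max_le hT0.le
      rw [div_le_iff₀ hD]
      have h1 : s ≤ T * (s - r) := by
        have : s * (ρ * s) ≤ s * (T * (ρ * (s - r))) :=
          mul_le_mul_of_nonneg_left (hs.trans hT) hs0.le
        have : ρ * (s * s) ≤ ρ * (s * (T * (s - r))) := by linarith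
        have := le_of_mul_le_mul_left (le_of_mul_le_mul_left this hρ) hs0
        exact this
      have h2 : s * (s + r) ≤ T * (s - r) * (s + r) := by gcongr
      nlinarith [sq_nonneg ‖x - x0‖]
    have hg : gsq (cut x0 r s) x = 16 * m ^ 2 * (‖x - x0‖ / (s ^ 2 - r ^ 2)) ^ 2 := by
      unfold gsq
      simp_rw [cut_hasFDerivAt, ← hm]
      rw [div_pow, EuclideanSpace.norm_sq_eq, Finset.sum_div, Finset.mul_sum]
      refine Finset.sum_congr rfl fun i _ => ?_
      simp only [PiLp.sub_apply, Real.norm_eq_abs, sq_abs]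
      field_simp
      ring
    have hq : ‖x - x0‖ / (s ^ 2 - r ^ 2) ≤ ρ * T := by
      rw [div_le_iff₀ hD]
      have h2 : 1 * (s + r) ≤ T * (ρ * (s - r)) * (s + r) := by gcongr
      nlinarith
    have hq0 : 0 ≤ ‖x - x0‖ / (s ^ 2 - r ^ 2) := by positivity
    have e1 : gsq (cut x0 r s) x ≤ 16 * T ^ 2 * (ρ * T) ^ 2 := by rw [hg]; gcongr
    have e2 : cut x0 r s x = m ^ 2 := rfl
    have e3 : (m ^ 2) ^ 2 ≤ (T ^ 2) ^ 2 := by gcongr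
    have e4 : ρ ^ 2 * (m ^ 2) ^ 2 ≤ ρ ^ 2 * (T ^ 2) ^ 2 := by gcongr
    rw [e2]
    linarith
  · rw [indicator_of_notMem hx]
    have h0 := cut_zero hr hrs hx
    simp [gsq, cut_hasFDerivAt, h0, cut]

/-- Sobolev inequality, real form -/
lemma sobolev_real (m : ℕ) (hm : 1 ≤ m) : ∃ S : ℝ, 1 ≤ S ∧
    ∀ Y : EuclideanSpace ℝ (Fin (m + 1)) → ℝ, ContDiff ℝ 1 Y → HasCompactSupport Y →
      (∀ x, 0 ≤ Y x) →
      ∫ x, Y x ^ (((m : ℝ) + 1) / m) ≤ (S * ∫ x, ‖fderiv ℝ Y x‖) ^ (((m : ℝ) + 1) / m) := by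
  have hm0 : (0 : ℝ) < m := by exact_mod_cast hm
  set χ : ℝ := ((m : ℝ) + 1) / m with hχ
  have hχ1 : 1 ≤ χ := by rw [hχ, one_le_div hm0]; linarith
  set C := lintegralPowLePowLIntegralFDerivConst
    (volume : Measure (EuclideanSpace ℝ (Fin (m + 1)))) χ with hC
  refine ⟨max 1 C, le_max_left _ _, fun Y hY hc h0 => ?_⟩
  have hconj : Real.HolderConjugate
      (Module.finrank ℝ (EuclideanSpace ℝ (Fin (m + 1))) : ℝ) χ := by
    rw [finrank_euclideanSpace_fin, Real.holderConjugate_iff]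
    push_cast
    refine ⟨by linarith, ?_⟩
    rw [hχ]; field_simp; ring
  have h := lintegral_pow_le_pow_lintegral_fderiv
    (volume : Measure (EuclideanSpace ℝ (Fin (m + 1)))) hY hc hconj
  have hcf : Continuous (fderiv ℝ Y) := hY.continuous_fderiv one_ne_zero
  have hif : Integrable (fderiv ℝ Y) :=
    hcf.integrable_of_hasCompactSupport (hc.fderiv (𝕜 := ℝ))
  have hχ0 : 0 < χ := by linarith
  have hiY : Integrable (fun x => Y x ^ χ) := by
    refine Continuous.integrable_of_hasCompactSupport
      (hY.continuous.rpow_const fun x => Or.inr hχ0.le) ?_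
    refine HasCompactSupport.intro hc.isCompact fun x hx => ?_
    rw [image_eq_zero_of_notMem_tsupport hx, Real.zero_rpow hχ0.ne']
  have e1 : ∫⁻ x, ‖Y x‖ₑ ^ χ = ENNReal.ofReal (∫ x, Y x ^ χ) := by
    rw [ofReal_integral_eq_lintegral_ofReal hiY
      (Eventually.of_forall fun x => Real.rpow_nonneg (h0 x) _)]
    refine lintegral_congr fun x => ?_
    rw [Real.enorm_eq_ofReal (h0 x), ENNReal.ofReal_rpow_of_nonneg (h0 x) hχ0.le]
  have e2 : ∫⁻ x, ‖fderiv ℝ Y x‖ₑ = ENNReal.ofReal (∫ x, ‖fderiv ℝ Y x‖) :=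
    (ofReal_integral_norm_eq_lintegral_enorm hif).symm
  have hI0 : 0 ≤ ∫ x, ‖fderiv ℝ Y x‖ := integral_nonneg fun _ => norm_nonneg _
  rw [e1, e2, ENNReal.ofReal_rpow_of_nonneg hI0 hχ0.le, ← ENNReal.ofReal_coe_nnreal,
    ← ENNReal.ofReal_mul (by positivity)] at h
  have h' := (ENNReal.ofReal_le_ofReal_iff (by positivity)).1 h
  refine h'.trans ?_
  rw [Real.mul_rpow (by positivity) hI0]
  refine mul_le_mul_of_nonneg_right ?_ (by positivity)
  refine (le_max_right 1 (C : ℝ)).trans ?_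
  exact Real.self_le_rpow_of_one_le (le_max_left _ _) hχ1

lemma Y_contDiff {d : ℕ} {w η : EuclideanSpace ℝ (Fin d) → ℝ} (hw : ContDiff ℝ 1 w)
    (hη : ContDiff ℝ 1 η) {κ : ℝ} (hκ : 0 < κ) (α : ℝ) :
    ContDiff ℝ 1 (fun x => η x ^ 2 * (w x ^ 2 + κ) ^ α) :=
  (hη.pow 2).mul (((hw.pow 2).add contDiff_const).rpow_const_of_ne
    fun x => (add_pos_of_nonneg_of_pos (sq_nonneg (w x)) hκ).ne')

lemma Y_fderiv_le {d : ℕ} {w η : EuclideanSpace ℝ (Fin d) → ℝ} (hw : ContDiff ℝ 1 w)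
    (hη : ContDiff ℝ 1 η) {κ ρ β : ℝ} (hκ : 0 < κ) (hρ : 0 < ρ) (hβ : 0 ≤ β)
    (x : EuclideanSpace ℝ (Fin d)) :
    ‖fderiv ℝ (fun x => η x ^ 2 * (w x ^ 2 + κ) ^ (β + 1)) x‖ ≤
      ρ⁻¹ * ((β + 2) * ((w x ^ 2 + κ) ^ (β + 1) * (gsq η x + ρ ^ 2 * η x ^ 2)) +
        (β + 1) * (η x ^ 2 * (w x ^ 2 + κ) ^ β * gsq w x)) := by
  have h1 := (hw.differentiable one_ne_zero x).hasFDerivAt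
  have h2 := (hη.differentiable one_ne_zero x).hasFDerivAt
  have hz : 0 < w x ^ 2 + κ := by positivity
  have h3 := (((h1.pow 2).add_const κ).rpow_const (p := β + 1) (Or.inl hz.ne'))
  have h4 := (h2.pow 2).mul h3
  have h5 := h4.fderiv
  simp only [Pi.mul_def, add_sub_cancel_right] at h5
  rw [h5]
  set p := ‖fderiv ℝ w x‖ with hp
  set e := ‖fderiv ℝ η x‖ with he
  have hpg : p ^ 2 ≤ gsq w x := norm_fderiv_sq_le w x
  have heg : e ^ 2 ≤ gsq η x := norm_fderiv_sq_le η x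
  set z := w x ^ 2 + κ with hzz
  have hzb : 0 < z ^ β := Real.rpow_pos_of_pos hz _
  have hmul : z ^ (β + 1) = z ^ β * z := by rw [Real.rpow_add hz, Real.rpow_one]
  rw [hmul]
  have hwz : |w x| ^ 2 ≤ z := by rw [sq_abs]; linarith
  have hp0 : 0 ≤ p := norm_nonneg _
  have he0 : 0 ≤ e := norm_nonneg _
  have b1 : 2 * |η x| * e ≤ ρ⁻¹ * (e ^ 2 + ρ ^ 2 * η x ^ 2) := by
    rw [le_inv_mul_iff₀ hρ, ← sq_abs (η x)]
    nlinarith [sq_nonneg (e - ρ * |η x|)]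
  have b2 : 2 * |w x| * p ≤ ρ⁻¹ * (p ^ 2 + ρ ^ 2 * z) := by
    rw [le_inv_mul_iff₀ hρ]
    have : ρ ^ 2 * |w x| ^ 2 ≤ ρ ^ 2 * z := by gcongr
    nlinarith [sq_nonneg (p - ρ * |w x|)]
  calc _ ≤ η x ^ 2 * ((β + 1) * z ^ β * (2 * |w x| * p)) + z ^ β * z * (2 * |η x| * e) := by
        refine (norm_add_le _ _).trans (le_of_eq ?_)
        simp only [norm_smul, Real.norm_eq_abs, abs_mul, abs_pow, sq_abs, abs_of_pos hzb,
          abs_of_pos hz, ← hp, ← he, abs_of_nonneg (by linarith : 0 ≤ β + 1),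
          nsmul_eq_mul, Nat.cast_ofNat, abs_two, Nat.add_one_sub_one, pow_one]
    _ ≤ η x ^ 2 * ((β + 1) * z ^ β * (ρ⁻¹ * (p ^ 2 + ρ ^ 2 * z)))
        + z ^ β * z * (ρ⁻¹ * (e ^ 2 + ρ ^ 2 * η x ^ 2)) := by gcongr
    _ ≤ η x ^ 2 * ((β + 1) * z ^ β * (ρ⁻¹ * (gsq w x + ρ ^ 2 * z)))
        + z ^ β * z * (ρ⁻¹ * (gsq η x + ρ ^ 2 * η x ^ 2)) := by gcongr
    _ ≤ _ := by
        have : 0 ≤ ρ⁻¹ * ((β + 1) * (z ^ β * z * gsq η x)) := by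
          have := gsq_nonneg η x
          positivity
        linarith

/-- one Moser step -/
lemma moser_step (m : ℕ) (hm : 1 ≤ m) {ν : ℝ} (hν : 0 < ν) : ∃ C : ℝ, 1 ≤ C ∧
    ∀ (a : Fin (m + 1) → Fin (m + 1) → EuclideanSpace ℝ (Fin (m + 1)) → ℝ), Ell ν a →
    ∀ (w : EuclideanSpace ℝ (Fin (m + 1)) → ℝ)
      (g : Fin (m + 1) → EuclideanSpace ℝ (Fin (m + 1)) → ℝ) (G : ℝ)
      (x0 : EuclideanSpace ℝ (Fin (m + 1))) (R : ℝ), 0 < R → Sol a w g G x0 (2 * R) →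
    ∀ (κ r s T α : ℝ), 0 < κ → G ^ 2 ≤ R⁻¹ ^ 2 * κ → 0 ≤ r → r < s → s ≤ R →
      1 ≤ T * (R⁻¹ * (s - r)) → 1 ≤ α →
      ∫ x in ball x0 r, (w x ^ 2 + κ) ^ (α * (((m : ℝ) + 1) / m)) ≤
        (C * R⁻¹ * (α ^ 2 * T ^ 4) * ∫ x in ball x0 s, (w x ^ 2 + κ) ^ α)
          ^ (((m : ℝ) + 1) / m) := by
  obtain ⟨S, hS1, hSob⟩ := sobolev_real m hm
  set D := 2 * ν⁻¹ * (4 * ν⁻¹ ^ 3 + ν⁻¹ + 1) with hD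
  have hD0 : 0 < D := by positivity
  refine ⟨17 * S * (2 + 2 * D), by nlinarith, ?_⟩
  intro a ha w g G x0 R hR hSol κ r s T α hκ hG hr hrs hsR hT hα
  have hm0 : (0 : ℝ) < m := by exact_mod_cast hm
  set χ : ℝ := ((m : ℝ) + 1) / m with hχ
  have hχ0 : 0 < χ := by positivity
  set ρ := R⁻¹ with hρ
  have hρ0 : 0 < ρ := inv_pos.2 hR
  have hs0 : 0 < s := by linarith
  have hρs : ρ * s ≤ 1 := by rw [hρ, inv_mul_le_iff₀ hR]; linarith
  set η := cut x0 r s with hη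
  have hη1 : ContDiff ℝ 1 η := cut_contDiff _ _ _
  have hηc : HasCompactSupport η := cut_hasCompactSupport hr hrs
  have hηs : tsupport η ⊆ ball x0 (2 * R) :=
    (cut_tsupport hr hrs).trans (closedBall_subset_ball (by linarith))
  obtain ⟨β, rfl⟩ : ∃ β, α = β + 1 := ⟨α - 1, by ring⟩
  have hβ : 0 ≤ β := by linarith
  have hw := hSol.hw
  have hcac := caccioppoli ha hSol hη1 hηc hηs hκ hG hβ
  rw [← hD] at hcac
  have hRR := rhs_integrable hw hη1 hηc hκ (β + 1) ρ
  have hLL := lhs_integrable hw hη1 hηc hκ β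
  set B := ∫ x, (w x ^ 2 + κ) ^ (β + 1) * (gsq η x + ρ ^ 2 * η x ^ 2) with hB
  set I := ∫ x, η x ^ 2 * (w x ^ 2 + κ) ^ β * gsq w x with hI
  have hzpos : ∀ x, 0 < w x ^ 2 + κ := fun x => by positivity
  set J := ∫ x in ball x0 s, (w x ^ 2 + κ) ^ (β + 1) with hJ
  have hJ0 : 0 ≤ J := integral_nonneg fun x => Real.rpow_nonneg (hzpos x).le _
  have hzi : ∀ (γ t : ℝ), IntegrableOn (fun x => (w x ^ 2 + κ) ^ γ) (ball x0 t) := fun γ t =>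
    ((z_rpow_continuous hw hκ γ).continuousOn.integrableOn_compact
      (isCompact_closedBall x0 t)).mono_set ball_subset_closedBall
  have hBJ : B ≤ 17 * ρ ^ 2 * T ^ 4 * J := by
    rw [hB, hJ, ← integral_const_mul, ← integral_indicator measurableSet_ball]
    refine integral_mono hRR (IntegrableOn.integrable_indicator
      ((hzi _ _).const_mul _) measurableSet_ball) ?_
    intro x
    have := cut_bound (x0 := x0) hr hrs hρ0 hρs hT x
    have h2 := mul_le_mul_of_nonneg_left this (Real.rpow_nonneg (hzpos x).le (β + 1))
    refine h2.trans (le_of_eq ?_)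
    by_cases hx : x ∈ ball x0 s
    · simp only [indicator_of_mem hx]; ring
    · simp only [indicator_of_notMem hx, mul_zero]
  have hB0 : 0 ≤ B := integral_nonneg fun x => mul_nonneg (Real.rpow_nonneg (hzpos x).le _)
    (add_nonneg (gsq_nonneg _ _) (by positivity))
  set Y : EuclideanSpace ℝ (Fin (m + 1)) → ℝ := fun x => η x ^ 2 * (w x ^ 2 + κ) ^ (β + 1) with hY
  have hY1 : ContDiff ℝ 1 Y := Y_contDiff hw hη1 hκ _
  have hYc : HasCompactSupport Y :=
    hηc.of_isClosed_subset (isClosed_tsupport _) tsupport_sq_mul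
  have hY0 : ∀ x, 0 ≤ Y x := fun x =>
    mul_nonneg (sq_nonneg _) (Real.rpow_nonneg (hzpos x).le _)
  have hsob := hSob Y hY1 hYc hY0
  have hDY : ∫ x, ‖fderiv ℝ Y x‖ ≤ ρ⁻¹ * ((β + 2) * B + (β + 1) * I) := by
    rw [hB, hI, ← integral_const_mul, ← integral_const_mul, ← integral_add (hRR.const_mul _)
      (hLL.const_mul _), ← integral_const_mul]
    refine integral_mono ?_ (((hRR.const_mul _).add (hLL.const_mul _)).const_mul _)
      (fun x => Y_fderiv_le hw hη1 hκ hρ0 hβ x)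
    exact ((hY1.continuous_fderiv one_ne_zero).integrable_of_hasCompactSupport
      (hYc.fderiv (𝕜 := ℝ))).norm
  have hfin : S * ∫ x, ‖fderiv ℝ Y x‖ ≤
      17 * S * (2 + 2 * D) * ρ * ((β + 1) ^ 2 * T ^ 4) * J := by
    calc S * ∫ x, ‖fderiv ℝ Y x‖ ≤ S * (ρ⁻¹ * ((β + 2) * B + (β + 1) * I)) := by gcongr
      _ ≤ S * (ρ⁻¹ * ((β + 2) * B + (β + 1) * (D * (1 + 2 * β) * B))) := by gcongr
      _ ≤ S * (ρ⁻¹ * ((2 + 2 * D) * (β + 1) ^ 2 * B)) := by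
          gcongr
          have : 0 ≤ D * B := by positivity
          nlinarith [mul_nonneg hβ hB0, mul_nonneg (mul_nonneg hβ hβ) hB0, mul_nonneg hβ this]
      _ ≤ S * (ρ⁻¹ * ((2 + 2 * D) * (β + 1) ^ 2 * (17 * ρ ^ 2 * T ^ 4 * J))) := by gcongr
      _ = _ := by field_simp
  have hX0 : 0 ≤ S * ∫ x, ‖fderiv ℝ Y x‖ :=
    mul_nonneg (by linarith) (integral_nonneg fun _ => norm_nonneg _)
  refine le_trans ?_ (hsob.trans (Real.rpow_le_rpow hX0 hfin hχ0.le))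
  rw [← integral_indicator measurableSet_ball]
  refine integral_mono ((hzi _ _).integrable_indicator measurableSet_ball) ?_ ?_
  · refine Continuous.integrable_of_hasCompactSupport
      (hY1.continuous.rpow_const fun x => Or.inr hχ0.le) ?_
    refine HasCompactSupport.intro hYc.isCompact fun x hx => ?_
    rw [image_eq_zero_of_notMem_tsupport hx, Real.zero_rpow hχ0.ne']
  · intro x
    by_cases hx : x ∈ ball x0 r
    · simp only [indicator_of_mem hx]
      have h1 : 1 ≤ η x := cut_ge_one hr hrs hx
      rw [Real.rpow_mul (hzpos x).le]
      refine Real.rpow_le_rpow (Real.rpow_nonneg (hzpos x).le _) ?_ hχ0.le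
      refine le_mul_of_one_le_left (Real.rpow_nonneg (hzpos x).le _) ?_
      nlinarith
    · simp only [indicator_of_notMem hx]
      exact Real.rpow_nonneg (hY0 x) _

lemma iter_bound (m : ℕ) (hm : 1 ≤ m) {C b : ℝ} (hC : 1 ≤ C) (hb : 1 ≤ b) (I : ℕ → ℝ)
    (hI : ∀ k, 0 ≤ I k)
    (hstep : ∀ k, I (k + 1) ≤ (C * b ^ k * I k) ^ (((m : ℝ) + 1) / m)) (k : ℕ) :
    I k ≤ (C * (C * b ^ (m + 1)) ^ m * I 0) ^ ((((m : ℝ) + 1) / m) ^ k) := by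
  have hm0 : (0 : ℝ) < m := by exact_mod_cast hm
  set χ : ℝ := ((m : ℝ) + 1) / m with hχ
  have hχ0 : 0 < χ := by positivity
  set D := C * b ^ (m + 1) with hD
  have hb0 : 0 < b := by linarith
  have hC0 : 0 < C := by linarith
  have hD1 : 1 ≤ D := one_le_mul_of_one_le_of_one_le hC (one_le_pow₀ hb)
  have hD0 : 0 < D := by linarith
  set τ := C * D ^ m * I 0 with hτ
  have hτ0 : 0 ≤ τ := mul_nonneg (by positivity) (hI 0)
  have claim : ∀ k, I k ≤ (C * D ^ m)⁻¹ * ((b ^ ((m + 1) * k))⁻¹ * τ ^ (χ ^ k)) := by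
    intro k
    induction k with
    | zero => simp [hτ]; field_simp; exact le_rfl
    | succ k ih =>
      refine (hstep k).trans ?_
      have hx0 : 0 ≤ C * b ^ k * I k := mul_nonneg (by positivity) (hI k)
      have h1 : C * b ^ k * I k ≤ ((D * b ^ k)⁻¹) ^ m * τ ^ (χ ^ k) := by
        calc C * b ^ k * I k
            ≤ C * b ^ k * ((C * D ^ m)⁻¹ * ((b ^ ((m + 1) * k))⁻¹ * τ ^ (χ ^ k))) := by gcongr
          _ = _ := by
              have e : b ^ ((m + 1) * k) = (b ^ k) ^ m * b ^ k := by
                rw [← pow_succ, ← pow_mul, mul_comm]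
              rw [e, inv_pow, mul_pow D (b ^ k) m]
              clear_value D
              field_simp
      refine (Real.rpow_le_rpow hx0 h1 hχ0.le).trans (le_of_eq ?_)
      have hinv : 0 ≤ (D * b ^ k)⁻¹ := by positivity
      rw [Real.mul_rpow (by positivity) (Real.rpow_nonneg hτ0 _), ← Real.rpow_mul hτ0, ← pow_succ,
        ← Real.rpow_natCast, ← Real.rpow_mul hinv]
      have e : (m : ℝ) * χ = ((m + 1 : ℕ) : ℝ) := by rw [hχ]; push_cast; field_simp
      rw [e, Real.rpow_natCast, ← mul_assoc]
      congr 1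
      rw [← mul_inv, inv_pow]
      congr 1
      rw [mul_pow, pow_succ D m]
      nth_rewrite 2 [hD]
      ring
  refine (claim k).trans ?_
  have h1 : (C * D ^ m)⁻¹ ≤ 1 := inv_le_one_of_one_le₀
    (one_le_mul_of_one_le_of_one_le hC (one_le_pow₀ hD1))
  have h2 : (b ^ ((m + 1) * k))⁻¹ ≤ 1 := inv_le_one_of_one_le₀ (one_le_pow₀ hb)
  have h3 : 0 ≤ τ ^ (χ ^ k) := Real.rpow_nonneg hτ0 _
  have h4 : (b ^ ((m + 1) * k))⁻¹ * τ ^ (χ ^ k) ≤ τ ^ (χ ^ k) := mul_le_of_le_one_left h3 h2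
  have h5 : 0 ≤ (b ^ ((m + 1) * k))⁻¹ * τ ^ (χ ^ k) := by positivity
  exact (mul_le_of_le_one_left h5 h1).trans h4

/-- local boundedness -/
lemma moser (m : ℕ) (hm : 1 ≤ m) {ν : ℝ} (hν : 0 < ν) : ∃ C : ℝ, 1 ≤ C ∧
    ∀ (a : Fin (m + 1) → Fin (m + 1) → EuclideanSpace ℝ (Fin (m + 1)) → ℝ), Ell ν a →
    ∀ (w : EuclideanSpace ℝ (Fin (m + 1)) → ℝ)
      (g : Fin (m + 1) → EuclideanSpace ℝ (Fin (m + 1)) → ℝ) (G : ℝ)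
      (x0 : EuclideanSpace ℝ (Fin (m + 1))) (R : ℝ), 0 < R → Sol a w g G x0 (2 * R) →
    ∀ κ : ℝ, 0 < κ → G ^ 2 ≤ R⁻¹ ^ 2 * κ →
      w x0 ^ 2 + κ ≤ C * (R⁻¹ ^ (m + 1) * ∫ x in ball x0 R, (w x ^ 2 + κ)) := by
  obtain ⟨C0, hC0, hst⟩ := moser_step m hm hν
  set C := C0 * 256 with hC
  have hC1 : 1 ≤ C := by linarith
  refine ⟨C * (C * 64 ^ (m + 1)) ^ m, one_le_mul_of_one_le_of_one_le hC1
    (one_le_pow₀ (one_le_mul_of_one_le_of_one_le hC1 (one_le_pow₀ (by norm_num)))), ?_⟩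
  intro a ha w g G x0 R hR hSol κ hκ hG
  have hm0 : (0 : ℝ) < m := by exact_mod_cast hm
  have hm1 : (1 : ℝ) ≤ m := by exact_mod_cast hm
  set χ : ℝ := ((m : ℝ) + 1) / m with hχ
  have hχ0 : 0 < χ := by positivity
  have hχ1 : 1 < χ := by rw [hχ, one_lt_div hm0]; linarith
  have hχ2 : χ ≤ 2 := by rw [hχ, div_le_iff₀ hm0]; linarith
  have hw := hSol.hw
  have hzpos : ∀ x, 0 < w x ^ 2 + κ := fun x => by positivity
  set r : ℕ → ℝ := fun k => R * (1 / 2 + (1 / 2) ^ (k + 1)) with hr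
  set J : ℕ → ℝ := fun k => ∫ x in ball x0 (r k), (w x ^ 2 + κ) ^ (χ ^ k) with hJ
  have hJ0 : ∀ k, 0 ≤ J k := fun k => integral_nonneg fun x => Real.rpow_nonneg (hzpos x).le _
  set ρ := R⁻¹ with hρ
  have hρ0 : 0 < ρ := inv_pos.2 hR
  have hρR : ρ * R = 1 := inv_mul_cancel₀ hR.ne'
  set I : ℕ → ℝ := fun k => ρ ^ (m + 1) * J k with hI
  have hI0 : ∀ k, 0 ≤ I k := fun k => mul_nonneg (by positivity) (hJ0 k)
  have hIstep : ∀ k, I (k + 1) ≤ (C * 64 ^ k * I k) ^ χ := by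
    intro k
    have hp : (0 : ℝ) < (1 / 2) ^ k := by positivity
    have hp1 : ((1 : ℝ) / 2) ^ k ≤ 1 := pow_le_one₀ (by norm_num) (by norm_num)
    have e12 : ((2 : ℝ) ^ k) * (1 / 2) ^ k = 1 := by rw [← mul_pow]; norm_num
    have h := hst a ha w g G x0 R hR hSol κ (r (k + 1)) (r k) (2 ^ (k + 2)) (χ ^ k) hκ hG
      (by simp only [hr]; positivity)
      (by simp only [hr, pow_succ]; nlinarith)
      (by simp only [hr, pow_succ]; nlinarith)
      (by
        have : (2 : ℝ) ^ (k + 2) * (R⁻¹ * (r k - r (k + 1))) = 1 := by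
          simp only [hr, ← hρ, pow_succ]
          calc _ = (2 ^ k * (1 / 2) ^ k) * (ρ * R) := by ring
            _ = 1 := by rw [e12, hρR, one_mul]
        exact this.ge)
      (one_le_pow₀ hχ1.le)
    rw [← pow_succ] at h
    have hJJ : J (k + 1) ≤ (C0 * R⁻¹ * ((χ ^ k) ^ 2 * (2 ^ (k + 2)) ^ 4) * J k) ^ χ := h
    have h64 : (χ ^ k) ^ 2 * ((2 : ℝ) ^ (k + 2)) ^ 4 ≤ 256 * 64 ^ k := by
      calc (χ ^ k) ^ 2 * ((2 : ℝ) ^ (k + 2)) ^ 4 ≤ (2 ^ k) ^ 2 * ((2 : ℝ) ^ (k + 2)) ^ 4 := by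
            gcongr
        _ = 256 * (2 ^ k) ^ 6 := by ring
        _ = _ := by
            have : (64 : ℝ) ^ k = (2 ^ k) ^ 6 := by
              rw [← pow_mul, mul_comm, pow_mul]; norm_num
            rw [this]
    have hJ2 : J (k + 1) ≤ (R ^ m * (C * 64 ^ k * I k)) ^ χ := by
      refine hJJ.trans (Real.rpow_le_rpow ?_ ?_ hχ0.le)
      · have := hJ0 k
        positivity
      · calc C0 * R⁻¹ * ((χ ^ k) ^ 2 * (2 ^ (k + 2)) ^ 4) * J k
            ≤ C0 * R⁻¹ * (256 * 64 ^ k) * J k := by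
              have := hJ0 k
              gcongr
          _ = (ρ * R) ^ m * (C0 * ρ * (256 * 64 ^ k) * J k) := by rw [hρR, one_pow, one_mul]
          _ = _ := by simp only [hI, hC, mul_pow, pow_succ]; ring
    rw [Real.mul_rpow (by positivity) (mul_nonneg (by positivity) (hI0 k)), ← Real.rpow_natCast,
      ← Real.rpow_mul hR.le] at hJ2
    have e : (m : ℝ) * χ = ((m + 1 : ℕ) : ℝ) := by rw [hχ]; push_cast; field_simp
    rw [e, Real.rpow_natCast] at hJ2
    calc I (k + 1) ≤ ρ ^ (m + 1) * (R ^ (m + 1) * (C * 64 ^ k * I k) ^ χ) := by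
          simp only [hI] at hJ2 ⊢; gcongr
      _ = (ρ * R) ^ (m + 1) * (C * 64 ^ k * I k) ^ χ := by ring
      _ = _ := by rw [hρR, one_pow, one_mul]
  have hall := iter_bound m hm hC1 (by norm_num : (1 : ℝ) ≤ 64) I hI0 hIstep
  have hI00 : I 0 = ρ ^ (m + 1) * ∫ x in ball x0 R, (w x ^ 2 + κ) := by
    have : r 0 = R := by simp only [hr]; norm_num
    simp only [hI, hJ, this, pow_zero, Real.rpow_one]
  rw [← hI00]
  set Λ := C * (C * 64 ^ (m + 1)) ^ m * I 0 with hΛ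
  by_contra hcon
  push Not at hcon
  obtain ⟨s, hs1, hs2⟩ := exists_between hcon
  have hΛ0 : 0 ≤ Λ := mul_nonneg (by positivity) (hI0 0)
  have hs0 : 0 < s := by linarith
  have hcont : Continuous (fun x => w x ^ 2 + κ) := (hw.continuous.pow 2).add continuous_const
  obtain ⟨t, ht, hball⟩ := Metric.isOpen_iff.1 (isOpen_lt continuous_const hcont) x0 hs2
  set t' := min t (R / 2) with ht'
  have ht'0 : 0 < t' := lt_min ht (by linarith)
  set v := (volume (ball x0 t')).toReal with hv
  have hv0 : 0 < v := ENNReal.toReal_pos (measure_ball_pos _ _ ht'0).ne' measure_ball_lt_top.ne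
  have hlow : ∀ k, ρ ^ (m + 1) * (v * s ^ (χ ^ k)) ≤ Λ ^ (χ ^ k) := by
    intro k
    refine le_trans ?_ (hall k)
    simp only [hI]
    refine mul_le_mul_of_nonneg_left ?_ (by positivity)
    have hzi : IntegrableOn (fun x => (w x ^ 2 + κ) ^ (χ ^ k)) (ball x0 (r k)) :=
      ((z_rpow_continuous hw hκ _).continuousOn.integrableOn_compact
        (isCompact_closedBall x0 _)).mono_set ball_subset_closedBall
    have hsub : ball x0 t' ⊆ ball x0 (r k) := by
      apply ball_subset_ball
      refine (min_le_right _ _).trans ?_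
      have : (0 : ℝ) < (1 / 2) ^ (k + 1) := by positivity
      simp only [hr]; nlinarith
    calc v * s ^ (χ ^ k) = ∫ x in ball x0 t', s ^ (χ ^ k) := by
          rw [setIntegral_const, smul_eq_mul]; rfl
      _ ≤ ∫ x in ball x0 t', (w x ^ 2 + κ) ^ (χ ^ k) := by
          refine setIntegral_mono_on (integrableOn_const measure_ball_lt_top.ne) (hzi.mono_set hsub)
            measurableSet_ball fun x hx => ?_
          have : s < w x ^ 2 + κ := hball (ball_subset_ball (min_le_left _ _) hx)
          exact Real.rpow_le_rpow hs0.le this.le (by positivity)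
      _ ≤ J k := setIntegral_mono_set hzi
          (Eventually.of_forall fun x => Real.rpow_nonneg (hzpos x).le _) hsub.eventuallyLE
  have hlow2 : ∀ k, ρ ^ (m + 1) * v ≤ (Λ / s) ^ (χ ^ k) := by
    intro k
    rw [Real.div_rpow hΛ0 hs0.le, le_div_iff₀ (Real.rpow_pos_of_pos hs0 _), mul_assoc]
    exact hlow k
  have hq1 : Λ / s < 1 := (div_lt_one hs0).2 hs1
  have hq0 : 0 ≤ Λ / s := by positivity
  have htend : Tendsto (fun k : ℕ => (Λ / s) ^ (χ ^ k)) atTop (nhds 0) :=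
    (tendsto_rpow_atTop_of_base_lt_one _ (by linarith) hq1).comp
      (tendsto_pow_atTop_atTop_of_one_lt hχ1)
  have := ge_of_tendsto' htend hlow2
  have : 0 < ρ ^ (m + 1) * v := by positivity
  linarith

/-- weak solution package on an open set, without bound on the right-hand side -/
structure Pre {d : ℕ} (a : Fin d → Fin d → EuclideanSpace ℝ (Fin d) → ℝ)
    (w : EuclideanSpace ℝ (Fin d) → ℝ) (g : Fin d → EuclideanSpace ℝ (Fin d) → ℝ)
    (U : Set (EuclideanSpace ℝ (Fin d))) : Prop where
  hw : ContDiff ℝ 1 w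
  hc : HasCompactSupport w
  hg : ∀ i, Integrable (g i)
  hE : WeakDiv (fun i x => (∑ j, a i j x * pd j w x) - g i x) U

lemma WeakDiv.mono {d : ℕ} {H : Fin d → EuclideanSpace ℝ (Fin d) → ℝ}
    {U U' : Set (EuclideanSpace ℝ (Fin d))} (hW : WeakDiv H U) (h : U' ⊆ U) : WeakDiv H U' :=
  fun φ h1 h2 h3 => hW φ h1 h2 (h3.trans h)

lemma Pre.mono {d : ℕ} {a : Fin d → Fin d → EuclideanSpace ℝ (Fin d) → ℝ}
    {w : EuclideanSpace ℝ (Fin d) → ℝ} {g : Fin d → EuclideanSpace ℝ (Fin d) → ℝ}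
    {U U' : Set (EuclideanSpace ℝ (Fin d))} (hP : Pre a w g U) (h : U' ⊆ U) : Pre a w g U' :=
  ⟨hP.hw, hP.hc, hP.hg, hP.hE.mono h⟩

lemma pd_diff {d : ℕ} {w : EuclideanSpace ℝ (Fin d) → ℝ} (hw : ContDiff ℝ 1 w)
    (h x : EuclideanSpace ℝ (Fin d)) (i : Fin d) :
    pd i (fun x => w (x + h) - w x) x = pd i w (x + h) - pd i w x := by
  rw [← pd_comp_add w h x i]
  unfold pd
  rw [fderiv_fun_sub ((contDiff_shift hw h).differentiable (by simp) x)
    (hw.differentiable (by simp) x)]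
  rfl

lemma Pre.diff {d : ℕ} {ν : ℝ} {a : Fin d → Fin d → EuclideanSpace ℝ (Fin d) → ℝ}
    (ha : Ell ν a)
    {w : EuclideanSpace ℝ (Fin d) → ℝ} {g : Fin d → EuclideanSpace ℝ (Fin d) → ℝ}
    {U U' : Set (EuclideanSpace ℝ (Fin d))} (hP : Pre a w g U) (h : EuclideanSpace ℝ (Fin d))
    (hinv : ∀ i j x, a i j (x + h) = a i j x) (hU : U' ⊆ U) (hU2 : ∀ x ∈ U', x + h ∈ U) :
    Pre a (fun x => w (x + h) - w x) (fun i x => g i (x + h) - g i x) U' := by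
  refine ⟨(contDiff_shift hP.hw h).sub hP.hw, ?_, fun i => ((hP.hg i).comp_add_right h).sub (hP.hg i), ?_⟩
  · exact (hasCompactSupport_shift hP.hc h).sub hP.hc
  · intro φ h1 h2 h3
    have hH : ∀ i, Integrable (fun x => (∑ j, a i j x * pd j w x) - g i x) := fun i =>
      (ha.integrable_flux hP.hw hP.hc i).sub (hP.hg i)
    have e1 := hP.hE.mono hU φ h1 h2 h3
    have e2 := (hP.hE.shift h).mono (U' := U') (fun x hx => hU2 x hx) φ h1 h2 h3
    have e3 : ∀ x, (∑ i, ((∑ j, a i j x * pd j (fun x => w (x + h) - w x) x)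
          - (g i (x + h) - g i x)) * pd i φ x)
        = (∑ i, ((∑ j, a i j (x + h) * pd j w (x + h)) - g i (x + h)) * pd i φ x)
          - ∑ i, ((∑ j, a i j x * pd j w x) - g i x) * pd i φ x := by
      intro x
      rw [← Finset.sum_sub_distrib]
      refine Finset.sum_congr rfl fun i _ => ?_
      rw [← sub_mul]
      congr 1
      have : ∑ j, a i j x * pd j (fun x => w (x + h) - w x) x
          = (∑ j, a i j (x + h) * pd j w (x + h)) - ∑ j, a i j x * pd j w x := by
        rw [← Finset.sum_sub_distrib]
        refine Finset.sum_congr rfl fun j _ => ?_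
        rw [pd_diff hP.hw, hinv, mul_sub]
      rw [this]; ring
    simp_rw [e3]
    rw [integral_sub, e1, e2, sub_zero]
    · exact integrable_finsetSum _ fun i _ =>
        integrable_mul_pd ((hH i).comp_add_right h) h1 h2 i
    · exact integrable_finsetSum _ fun i _ => integrable_mul_pd (hH i) h1 h2 i

lemma sq_integral_le {f : ℝ → ℝ} (hf : Continuous f) :
    (∫ t in (0 : ℝ)..1, f t) ^ 2 ≤ ∫ t in (0 : ℝ)..1, f t ^ 2 := by
  set c := ∫ t in (0 : ℝ)..1, f t with hc
  have h0 : 0 ≤ ∫ t in (0 : ℝ)..1, (f t - c) ^ 2 :=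
    intervalIntegral.integral_nonneg (by norm_num) fun t _ => sq_nonneg _
  have e : ∫ t in (0 : ℝ)..1, (f t - c) ^ 2 = (∫ t in (0 : ℝ)..1, f t ^ 2) - 2 * c * c + c ^ 2 := by
    have : ∀ t, (f t - c) ^ 2 = f t ^ 2 - 2 * c * f t + c ^ 2 := fun t => by ring
    simp_rw [this]
    rw [intervalIntegral.integral_add, intervalIntegral.integral_sub,
      intervalIntegral.integral_const_mul, intervalIntegral.integral_const]
    · simp [hc]
    all_goals exact Continuous.intervalIntegrable (by fun_prop) _ _
  nlinarith

lemma diff_sq_le {d : ℕ} {w : EuclideanSpace ℝ (Fin d) → ℝ} (hw : ContDiff ℝ 1 w)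
    (x h : EuclideanSpace ℝ (Fin d)) :
    (w (x + h) - w x) ^ 2 ≤ ‖h‖ ^ 2 * ∫ t in (0 : ℝ)..1, gsq w (x + t • h) := by
  have hcont : Continuous fun t : ℝ => fderiv ℝ w (x + t • h) := by
    have := hw.continuous_fderiv (by simp)
    fun_prop
  have hderiv : ∀ t : ℝ, HasDerivAt (fun t : ℝ => w (x + t • h)) (fderiv ℝ w (x + t • h) h) t := by
    intro t
    have h1 : HasDerivAt (fun t : ℝ => x + t • h) h t := by
      simpa using ((hasDerivAt_id t).smul_const h).const_add x
    exact ((hw.differentiable (by simp)) (x + t • h)).hasFDerivAt.comp_hasDerivAt t h1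
  have hftc := intervalIntegral.integral_eq_sub_of_hasDerivAt (a := 0) (b := 1)
    (fun t _ => hderiv t) (Continuous.intervalIntegrable (by fun_prop) _ _)
  simp only [one_smul, zero_smul, add_zero] at hftc
  rw [← hftc, ← intervalIntegral.integral_const_mul]
  refine (sq_integral_le (by fun_prop)).trans ?_
  have hg := gsq_continuous hw
  refine intervalIntegral.integral_mono (by norm_num) (Continuous.intervalIntegrable (by fun_prop) _ _)
    (Continuous.intervalIntegrable (by fun_prop) _ _) fun t => ?_
  have h1 := (fderiv ℝ w (x + t • h)).le_opNorm h
  have h2 := norm_fderiv_sq_le w (x + t • h)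
  calc (fderiv ℝ w (x + t • h) h) ^ 2 = ‖fderiv ℝ w (x + t • h) h‖ ^ 2 := by simp
    _ ≤ (‖fderiv ℝ w (x + t • h)‖ * ‖h‖) ^ 2 := by gcongr
    _ = ‖h‖ ^ 2 * ‖fderiv ℝ w (x + t • h)‖ ^ 2 := by ring
    _ ≤ _ := by gcongr

lemma gsq_hcs {d : ℕ} {w : EuclideanSpace ℝ (Fin d) → ℝ} 
    (hc : HasCompactSupport w) : HasCompactSupport (gsq w) := by
  refine HasCompactSupport.intro hc fun x hx => ?_
  simp [gsq, pd_eq_zero hx]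

lemma shift_integral_le {d : ℕ} {F : EuclideanSpace ℝ (Fin d) → ℝ} (hF : Integrable F)
    (hF0 : ∀ x, 0 ≤ F x) (y h : EuclideanSpace ℝ (Fin d)) {r : ℝ} (hh : ‖h‖ ≤ r) :
    ∫ x in ball y r, F (x + h) ≤ ∫ x in ball y (2 * r), F x := by
  rw [← integral_indicator measurableSet_ball, ← integral_indicator measurableSet_ball,
    ← integral_add_right_eq_self ((ball y (2 * r)).indicator F) h]
  refine integral_mono ?_ ?_ fun x => ?_
  · exact (hF.comp_add_right h).indicator measurableSet_ball
  · exact (hF.indicator measurableSet_ball).comp_add_right h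
  · by_cases hx : x ∈ ball y r
    · have h2 : x + h ∈ ball y (2 * r) := by
        rw [mem_ball, dist_eq_norm] at hx ⊢
        calc ‖x + h - y‖ = ‖(x - y) + h‖ := by congr 1; abel
          _ ≤ ‖x - y‖ + ‖h‖ := norm_add_le _ _
          _ < _ := by linarith
      simp only [indicator_of_mem hx, indicator_of_mem h2, le_refl]
    · rw [indicator_of_notMem hx]
      exact indicator_nonneg (fun _ _ => hF0 _) _

lemma diff_sq_integral_le {d : ℕ} {w : EuclideanSpace ℝ (Fin d) → ℝ} (hw : ContDiff ℝ 1 w)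
    (hc : HasCompactSupport w) (y h : EuclideanSpace ℝ (Fin d)) {r : ℝ} (hh : ‖h‖ ≤ r) :
    ∫ x in ball y r, (w (x + h) - w x) ^ 2 ≤ ‖h‖ ^ 2 * ∫ x in ball y (2 * r), gsq w x := by
  have hwc := hw.continuous
  have hg := gsq_continuous hw
  have hgi : Integrable (gsq w) := hg.integrable_of_hasCompactSupport (gsq_hcs hc)
  obtain ⟨B, hB⟩ := (gsq_hcs hc).exists_bound_of_continuous hg
  have : IsFiniteMeasure (volume.restrict (ball y r)) := ⟨by simpa using measure_ball_lt_top⟩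
  have hint2 : Integrable (fun p : EuclideanSpace ℝ (Fin d) × ℝ => gsq w (p.1 + p.2 • h))
      ((volume.restrict (ball y r)).prod (volume.restrict (Ioc (0 : ℝ) 1))) :=
    Integrable.of_bound (C := B) (by
      have : Continuous (fun p : EuclideanSpace ℝ (Fin d) × ℝ => gsq w (p.1 + p.2 • h)) := by
        fun_prop
      exact this.aestronglyMeasurable) (Eventually.of_forall fun p => hB _)
  have hdi : IntegrableOn (fun x => (w (x + h) - w x) ^ 2) (ball y r) := by
    have : Continuous (fun x => (w (x + h) - w x) ^ 2) := by fun_prop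
    exact (this.continuousOn.integrableOn_compact (isCompact_closedBall y r)).mono_set
      ball_subset_closedBall
  have hrhs := hint2.integral_prod_left
  have hrhs2 := hint2.integral_prod_right
  calc ∫ x in ball y r, (w (x + h) - w x) ^ 2
      ≤ ∫ x in ball y r, ‖h‖ ^ 2 * ∫ t in Ioc (0 : ℝ) 1, gsq w (x + t • h) := by
        refine integral_mono hdi (hrhs.const_mul _) fun x => ?_
        have := diff_sq_le hw x h
        rwa [intervalIntegral.integral_of_le (by norm_num)] at this
    _ = ‖h‖ ^ 2 * ∫ t in Ioc (0 : ℝ) 1, ∫ x in ball y r, gsq w (x + t • h) := by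
        rw [integral_const_mul, integral_integral_swap hint2]
    _ ≤ ‖h‖ ^ 2 * ∫ t in Ioc (0 : ℝ) 1, ∫ x in ball y (2 * r), gsq w x := by
        refine mul_le_mul_of_nonneg_left ?_ (sq_nonneg _)
        refine setIntegral_mono_on hrhs2 (integrableOn_const (by simp)) measurableSet_Ioc ?_
        intro t ht
        refine shift_integral_le hgi (gsq_nonneg w) y (t • h) ?_
        rw [norm_smul, Real.norm_eq_abs, abs_of_pos ht.1]
        nlinarith [norm_nonneg h, ht.2]
    _ = _ := by simp

lemma vol_ball (m : ℕ) (y : EuclideanSpace ℝ (Fin (m + 1))) {r : ℝ} (hr : 0 ≤ r) :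
    volume.real (ball y r) =
      r ^ (m + 1) * volume.real (ball (0 : EuclideanSpace ℝ (Fin (m + 1))) 1) := by
  rw [measureReal_def, measureReal_def, Measure.addHaar_ball _ _ hr, ENNReal.toReal_mul,
    ENNReal.toReal_ofReal (by positivity), finrank_euclideanSpace_fin]

lemma grad_bound (m : ℕ) {ν : ℝ} (hν : 0 < ν) : ∃ C : ℝ, 0 < C ∧
    ∀ (a : Fin (m + 1) → Fin (m + 1) → EuclideanSpace ℝ (Fin (m + 1)) → ℝ), Ell ν a →
    ∀ (V : EuclideanSpace ℝ (Fin (m + 1)) → ℝ)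
      (g : Fin (m + 1) → EuclideanSpace ℝ (Fin (m + 1)) → ℝ) (G : ℝ)
      (y : EuclideanSpace ℝ (Fin (m + 1))) (r : ℝ), 0 < r → Sol a V g G y (4 * r) →
    ∀ κ μ : ℝ, 0 < κ → 9 * r ^ 2 * G ^ 2 ≤ κ → (∀ x ∈ ball y (4 * r), |V x| ≤ μ) →
      r ^ 2 * (r⁻¹ ^ (m + 1) * ∫ x in ball y (2 * r), gsq V x) ≤ C * (μ ^ 2 + κ) := by
  set ω := volume.real (ball (0 : EuclideanSpace ℝ (Fin (m + 1))) 1) with hω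
  have hω0 : 0 < ω := ENNReal.toReal_pos (measure_ball_pos _ _ one_pos).ne' measure_ball_lt_top.ne
  set c := 2 * ν⁻¹ * (4 * ν⁻¹ ^ 3 + ν⁻¹ + 1) with hc
  have hc0 : 0 < c := by positivity
  refine ⟨c * (153 * (3 ^ (m + 1) * ω)), by positivity, ?_⟩
  intro a ha V g G y r hr hS κ μ hκ hG hμ
  have hVc := hS.hw.continuous
  have hgc := gsq_continuous hS.hw
  set ρ := (3 * r)⁻¹ with hρ
  have hρ0 : 0 < ρ := by positivity
  have hρr : ρ * (3 * r) = 1 := inv_mul_cancel₀ (by positivity)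
  set η := cut y (2 * r) (3 * r) with hη
  have hη1 : ContDiff ℝ 1 η := cut_contDiff _ _ _
  have hηc : HasCompactSupport η := cut_hasCompactSupport (by positivity) (by linarith)
  have hηs : tsupport η ⊆ ball y (4 * r) :=
    (cut_tsupport (by positivity) (by linarith)).trans (closedBall_subset_ball (by linarith))
  have hGκ : G ^ 2 ≤ ρ ^ 2 * κ := by
    have e : ρ ^ 2 * (9 * r ^ 2 * G ^ 2) = (ρ * (3 * r)) ^ 2 * G ^ 2 := by ring
    rw [hρr, one_pow, one_mul] at e
    rw [← e]; gcongr
  have hcac := caccioppoli ha hS hη1 hηc hηs (β := 0) hκ hGκ le_rfl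
  simp only [Real.rpow_zero, mul_one, mul_zero, add_zero, zero_add, Real.rpow_one] at hcac
  have hL : ∫ x in ball y (2 * r), gsq V x ≤ ∫ x, η x ^ 2 * gsq V x := by
    rw [← integral_indicator measurableSet_ball]
    have hi : Integrable (gsq V) := hgc.integrable_of_hasCompactSupport (gsq_hcs hS.hc)
    refine integral_mono (hi.indicator measurableSet_ball) ?_ fun x => ?_
    · refine Continuous.integrable_of_hasCompactSupport ?_ ?_
      · have := hη1.continuous
        fun_prop
      · exact HasCompactSupport.mul_left (gsq_hcs hS.hc)
    · by_cases hx : x ∈ ball y (2 * r)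
      · rw [indicator_of_mem hx]
        have h1 : 1 ≤ η x := cut_ge_one (by positivity) (by linarith) hx
        have h2 : 1 ≤ η x ^ 2 := one_le_pow₀ h1
        exact le_mul_of_one_le_left (gsq_nonneg _ _) h2
      · rw [indicator_of_notMem hx]
        exact mul_nonneg (sq_nonneg _) (gsq_nonneg _ _)
  have hR : ∫ x, (V x ^ 2 + κ) * (gsq η x + ρ ^ 2 * η x ^ 2) ≤
      (μ ^ 2 + κ) * (17 * ρ ^ 2 * 3 ^ 4) * ((3 * r) ^ (m + 1) * ω) := by
    have : (μ ^ 2 + κ) * (17 * ρ ^ 2 * 3 ^ 4) * ((3 * r) ^ (m + 1) * ω)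
        = ∫ x in ball y (3 * r), (μ ^ 2 + κ) * (17 * ρ ^ 2 * 3 ^ 4) := by
      rw [setIntegral_const, vol_ball m y (by positivity), smul_eq_mul, mul_comm]
    rw [this, ← integral_indicator measurableSet_ball]
    refine integral_mono_of_nonneg (Eventually.of_forall fun x => ?_) ?_
      (Eventually.of_forall fun x => ?_)
    · have := gsq_nonneg η x
      simp only [Pi.zero_apply]
      positivity
    · exact (integrableOn_const (by exact measure_ball_lt_top.ne)).integrable_indicator
        measurableSet_ball
    · have hb := cut_bound (x0 := y) (r := 2 * r) (s := 3 * r) (ρ := ρ) (T := 3) (by positivity)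
        (by linarith) hρ0 hρr.le (by linarith) x
      have hV : 0 < V x ^ 2 + κ := by positivity
      by_cases hx : x ∈ ball y (3 * r)
      · rw [indicator_of_mem hx] at hb ⊢
        have hx4 : x ∈ ball y (4 * r) := ball_subset_ball (by linarith) hx
        have hV2 : V x ^ 2 ≤ μ ^ 2 := by
          rw [← sq_abs]; gcongr; exact hμ x hx4
        have := gsq_nonneg η x
        exact mul_le_mul (by linarith) hb (by positivity) (by positivity)
      · rw [indicator_of_notMem hx] at hb ⊢
        exact mul_nonpos_of_nonneg_of_nonpos hV.le hb
  have hfin : ∫ x in ball y (2 * r), gsq V x ≤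
      c * ((μ ^ 2 + κ) * (17 * ρ ^ 2 * 3 ^ 4) * ((3 * r) ^ (m + 1) * ω)) :=
    hL.trans (hcac.trans (mul_le_mul_of_nonneg_left hR hc0.le))
  calc r ^ 2 * (r⁻¹ ^ (m + 1) * ∫ x in ball y (2 * r), gsq V x)
      ≤ r ^ 2 * (r⁻¹ ^ (m + 1) *
        (c * ((μ ^ 2 + κ) * (17 * ρ ^ 2 * 3 ^ 4) * ((3 * r) ^ (m + 1) * ω)))) := by gcongr
    _ = (ρ * (3 * r)) ^ 2 * (r⁻¹ * r) ^ (m + 1) *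
        (c * (153 * (3 ^ (m + 1) * ω)) * (μ ^ 2 + κ)) := by
        rw [mul_pow 3 r, mul_pow r⁻¹ r]; ring
    _ = _ := by rw [hρr, inv_mul_cancel₀ hr.ne']; simp

lemma lemmaS (m : ℕ) (hm : 1 ≤ m) {ν : ℝ} (hν : 0 < ν) : ∃ C : ℝ, 0 < C ∧
    ∀ (a : Fin (m + 1) → Fin (m + 1) → EuclideanSpace ℝ (Fin (m + 1)) → ℝ), Ell ν a →
    ∀ (V : EuclideanSpace ℝ (Fin (m + 1)) → ℝ)
      (g : Fin (m + 1) → EuclideanSpace ℝ (Fin (m + 1)) → ℝ) (G : ℝ)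
      (y h : EuclideanSpace ℝ (Fin (m + 1))) (r μ : ℝ), 0 < r → 0 ≤ G → 0 ≤ μ →
      Sol a V g G y (4 * r) → (∀ i j x, a i j (x + h) = a i j x) → ‖h‖ ≤ r →
      (∀ x ∈ ball y (4 * r), |V x| ≤ μ) →
      |V (y + h) - V y| ≤ C * (‖h‖ / r * μ + r * G) := by
  obtain ⟨Cm, hCm, hmos⟩ := moser m hm hν
  obtain ⟨Cg, hCg, hgr⟩ := grad_bound m hν
  set ω := volume.real (ball (0 : EuclideanSpace ℝ (Fin (m + 1))) 1) with hω
  have hω0 : 0 < ω := ENNReal.toReal_pos (measure_ball_pos _ _ one_pos).ne' measure_ball_lt_top.ne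
  set C2 := Cm * (Cg + ω) with hC2
  have hC20 : 0 < C2 := by positivity
  refine ⟨3 * Real.sqrt C2, by positivity, ?_⟩
  intro a ha V g G y h r μ hr hG hμ hS hinv hh hV
  set s := ‖h‖ / r with hs
  have hs0 : 0 ≤ s := by positivity
  have hs1 : s ≤ 1 := by rw [hs, div_le_one hr]; exact hh
  have hP : Pre a V g (ball y (4 * r)) := ⟨hS.hw, hS.hc, hS.hg, hS.hE⟩
  have hmem : ∀ x ∈ ball y (2 * r), x + h ∈ ball y (4 * r) := by
    intro x hx
    rw [mem_ball, dist_eq_norm] at hx ⊢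
    calc ‖x + h - y‖ = ‖(x - y) + h‖ := by congr 1; abel
      _ ≤ ‖x - y‖ + ‖h‖ := norm_add_le _ _
      _ < _ := by linarith
  have hsub : ball y (2 * r) ⊆ ball y (4 * r) := ball_subset_ball (by linarith)
  have hD := hP.diff ha h hinv hsub hmem
  have hSW : Sol a (fun x => V (x + h) - V x) (fun i x => g i (x + h) - g i x) (2 * G) y (2 * r) := by
    refine ⟨hD.hw, hD.hc, hD.hg, ?_, hD.hE⟩
    intro x hx
    have h1 := hS.hG x (hsub hx)
    have h2 := hS.hG _ (hmem x hx)
    calc ∑ i, (g i (x + h) - g i x) ^ 2 ≤ ∑ i, (2 * g i (x + h) ^ 2 + 2 * g i x ^ 2) :=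
          Finset.sum_le_sum fun i _ => by nlinarith [sq_nonneg (g i (x + h) + g i x)]
      _ = 2 * ∑ i, g i (x + h) ^ 2 + 2 * ∑ i, g i x ^ 2 := by
          rw [Finset.sum_add_distrib, Finset.mul_sum, Finset.mul_sum]
      _ ≤ _ := by nlinarith
  have hkey : ∀ ε : ℝ, 0 < ε →
      (V (y + h) - V y) ^ 2 ≤ C2 * (s ^ 2 * μ ^ 2 + 9 * r ^ 2 * G ^ 2) + ε := by
    intro ε hε
    set κ := 9 * r ^ 2 * G ^ 2 + ε / C2 with hκ
    have hε2 : 0 < ε / C2 := by positivity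
    have hκ0 : 0 < κ := by positivity
    have hrr : r⁻¹ * r = 1 := inv_mul_cancel₀ hr.ne'
    have h1 := hmos a ha _ _ _ y r hr hSW κ hκ0 (by
      have e : r⁻¹ ^ 2 * (9 * r ^ 2 * G ^ 2) = (r⁻¹ * r) ^ 2 * (9 * G ^ 2) := by ring
      rw [hrr] at e
      have : r⁻¹ ^ 2 * (9 * r ^ 2 * G ^ 2) ≤ r⁻¹ ^ 2 * κ := by gcongr; linarith
      nlinarith)
    have h2 := diff_sq_integral_le hS.hw hS.hc y h hh
    have h3 := hgr a ha V g G y r hr hS κ μ hκ0 (by linarith) hV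
    have h4 : ∫ x in ball y r, ((V (x + h) - V x) ^ 2 + κ)
        = (∫ x in ball y r, (V (x + h) - V x) ^ 2) + κ * (r ^ (m + 1) * ω) := by
      rw [integral_add, setIntegral_const, vol_ball m y hr.le, smul_eq_mul, mul_comm κ]
      · have hc : Continuous (fun x => (V (x + h) - V x) ^ 2) := by
          have := hS.hw.continuous
          fun_prop
        exact (hc.continuousOn.integrableOn_compact (isCompact_closedBall y r)).mono_set
          ball_subset_closedBall
      · exact integrableOn_const measure_ball_lt_top.ne
    set I := ∫ x in ball y (2 * r), gsq V x with hI
    have h5 : r⁻¹ ^ (m + 1) * ∫ x in ball y r, ((V (x + h) - V x) ^ 2 + κ)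
        ≤ s ^ 2 * (Cg * (μ ^ 2 + κ)) + κ * ω := by
      rw [h4]
      calc r⁻¹ ^ (m + 1) * ((∫ x in ball y r, (V (x + h) - V x) ^ 2) + κ * (r ^ (m + 1) * ω))
          ≤ r⁻¹ ^ (m + 1) * (‖h‖ ^ 2 * I + κ * (r ^ (m + 1) * ω)) := by gcongr
        _ = s ^ 2 * (r ^ 2 * (r⁻¹ ^ (m + 1) * I)) + (r⁻¹ * r) ^ (m + 1) * (κ * ω) := by
            have : ‖h‖ = s * r := by rw [hs]; field_simp
            rw [this, mul_pow r⁻¹ r]; ring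
        _ ≤ _ := by
            rw [hrr, one_pow, one_mul]
            gcongr
    have h6 : s ^ 2 * (Cg * (μ ^ 2 + κ)) + κ * ω ≤ (Cg + ω) * (s ^ 2 * μ ^ 2 + κ) := by
      have hs2 : s ^ 2 ≤ 1 := pow_le_one₀ hs0 hs1
      have : s ^ 2 * (Cg * κ) ≤ Cg * κ := mul_le_of_le_one_left (by positivity) hs2
      have : 0 ≤ ω * (s ^ 2 * μ ^ 2) := by positivity
      nlinarith
    calc (V (y + h) - V y) ^ 2 ≤ (V (y + h) - V y) ^ 2 + κ := by linarith
      _ ≤ Cm * ((Cg + ω) * (s ^ 2 * μ ^ 2 + κ)) :=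
          h1.trans (mul_le_mul_of_nonneg_left (h5.trans h6) (by linarith))
      _ = C2 * (s ^ 2 * μ ^ 2 + 9 * r ^ 2 * G ^ 2) + C2 * (ε / C2) := by rw [hC2, hκ]; ring
      _ = _ := by rw [mul_div_cancel₀ _ hC20.ne']
  have h7 := le_of_forall_pos_le_add hkey
  refine abs_le_of_sq_le_sq ?_ (by positivity)
  calc _ ≤ C2 * (s ^ 2 * μ ^ 2 + 9 * r ^ 2 * G ^ 2) := h7
    _ ≤ C2 * (9 * (s * μ + r * G) ^ 2) := by
        have : 0 ≤ s * μ := by positivity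
        have : 0 ≤ r * G := by positivity
        gcongr
        nlinarith [mul_nonneg ‹0 ≤ s * μ› ‹0 ≤ r * G›, sq_nonneg (s * μ)]
    _ = (3 * Real.sqrt C2 * (s * μ + r * G)) ^ 2 := by
        rw [mul_pow, mul_pow, Real.sq_sqrt hC20.le]; ring

/-- second difference -/
def D2 {E : Type*} [Add E] (v : E → ℝ) (h x : E) : ℝ :=
  (v (x + h + h) - v (x + h)) - (v (x + h) - v x)

lemma D2_identity {E : Type*} [AddCommGroup E] (v : E → ℝ) (h x : E) :
    4 * D2 v h x = D2 v (h + h) x - 3 * (D2 v h (x + h) - D2 v h x)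
      - (D2 v h (x + h + h) - D2 v h (x + h)) := by
  unfold D2
  have e1 : x + (h + h) + (h + h) = x + h + h + h + h := by abel
  have e2 : x + (h + h) = x + h + h := by abel
  rw [e1, e2]; ring

lemma D2_abs_le {E : Type*} [Add E] {v : E → ℝ} {M : ℝ} (hv : ∀ x, |v x| ≤ M) (h x : E) :
    |D2 v h x| ≤ 4 * M := by
  unfold D2
  have h1 := abs_le.1 (hv (x + h + h))
  have h2 := abs_le.1 (hv (x + h))
  have h3 := abs_le.1 (hv x)
  rw [abs_le]; constructor <;> linarith [h1.1, h1.2, h2.1, h2.2, h3.1, h3.2]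

lemma zyg_step (m : ℕ) (hm : 1 ≤ m) {ν : ℝ} (hν : 0 < ν) : ∃ C : ℝ, 0 < C ∧
    ∀ (S : Submodule ℝ (EuclideanSpace ℝ (Fin (m + 1))))
      (a : Fin (m + 1) → Fin (m + 1) → EuclideanSpace ℝ (Fin (m + 1)) → ℝ), Ell ν a →
      (∀ h ∈ S, ∀ i j x, a i j (x + h) = a i j x) →
    ∀ (v : EuclideanSpace ℝ (Fin (m + 1)) → ℝ)
      (f : Fin (m + 1) → EuclideanSpace ℝ (Fin (m + 1)) → ℝ) (K δ : ℝ), 0 ≤ K →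
      Pre a v f (ball 0 (9 / 10)) →
      (∀ i, ∀ x ∈ ball (0 : EuclideanSpace ℝ (Fin (m + 1))) (9 / 10), ∀ h ∈ S,
        x + h ∈ ball (0 : EuclideanSpace ℝ (Fin (m + 1))) (9 / 10) →
        |f i (x + h) - f i x| ≤ K * ‖h‖ ^ δ) →
    ∀ (x h : EuclideanSpace ℝ (Fin (m + 1))) (A μ : ℝ), 1 ≤ A → h ∈ S → h ≠ 0 →
      ‖x‖ + 7 * (A * ‖h‖) < 9 / 10 → (∀ z ∈ ball x (5 * (A * ‖h‖)), |D2 v h z| ≤ μ) →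
      4 * |D2 v h x| ≤ |D2 v (h + h) x| + C * (μ / A + A * K * (‖h‖ * ‖h‖ ^ δ)) := by
  obtain ⟨C, hC, hS⟩ := lemmaS m hm hν
  set q := Real.sqrt ((m : ℝ) + 1) with hq
  have hq0 : 0 ≤ q := Real.sqrt_nonneg _
  have hq2 : q ^ 2 = (m : ℝ) + 1 := Real.sq_sqrt (by positivity)
  refine ⟨4 * C * (1 + 2 * q), by positivity, ?_⟩
  intro S a ha hinv v f K δ hK hP hf x h A μ hA hhS hh hx hμ
  have hh0 : 0 < ‖h‖ := norm_pos_iff.2 hh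
  set r := A * ‖h‖ with hr
  have hhr : ‖h‖ ≤ r := le_mul_of_one_le_left hh0.le hA
  have hr0 : 0 < r := by linarith
  have hμ0 : 0 ≤ μ := (abs_nonneg _).trans (hμ x (mem_ball_self (by positivity)))
  set G := q * (2 * (K * ‖h‖ ^ δ)) with hG
  have hG0 : 0 ≤ G := by positivity
  have claim : ∀ y : EuclideanSpace ℝ (Fin (m + 1)), ‖y - x‖ ≤ ‖h‖ →
      |D2 v h (y + h) - D2 v h y| ≤ C * (μ / A + r * G) := by
    intro y hy
    have hz : ∀ z ∈ ball y (4 * r), ‖z‖ < 9 / 10 - 2 * r ∧ z ∈ ball x (5 * r) := by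
      intro z hz
      rw [mem_ball, dist_eq_norm] at hz
      have h1 : ‖z - x‖ ≤ ‖z - y‖ + ‖y - x‖ := norm_sub_le_norm_sub_add_norm_sub z y x
      have h2 : ‖z‖ ≤ ‖z - x‖ + ‖x‖ := by simpa using norm_add_le (z - x) x
      refine ⟨by linarith, ?_⟩
      rw [mem_ball, dist_eq_norm]; linarith
    have hz1 : ∀ z, ‖z‖ < 9 / 10 - 2 * r → z ∈ ball (0 : EuclideanSpace ℝ (Fin (m + 1))) (9 / 10) ∧
        z + h ∈ ball (0 : EuclideanSpace ℝ (Fin (m + 1))) (9 / 10) ∧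
        z + h + h ∈ ball (0 : EuclideanSpace ℝ (Fin (m + 1))) (9 / 10) := by
      intro z hz
      have h1 := norm_add_le z h
      have h2 := norm_add_le (z + h) h
      simp only [mem_ball_zero_iff]
      refine ⟨by linarith, by linarith, by linarith⟩
    have hP1 := hP.diff ha h (hinv h hhS) (U' := ball 0 (9 / 10 - r))
      (ball_subset_ball (by linarith)) (by
        intro z hz
        rw [mem_ball_zero_iff] at hz ⊢
        have h1 := norm_add_le z h
        linarith)
    have hP2 := hP1.diff ha h (hinv h hhS) (U' := ball y (4 * r))
      (fun z hzz => by
        have := (hz z hzz).1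
        rw [mem_ball_zero_iff]; linarith)
      (fun z hzz => by
        have := (hz z hzz).1
        have h1 := norm_add_le z h
        rw [mem_ball_zero_iff]; linarith)
    have hSol : Sol a (D2 v h) (fun i => D2 (f i) h) G y (4 * r) := by
      refine ⟨hP2.hw, hP2.hc, hP2.hg, ?_, hP2.hE⟩
      intro z hzz
      obtain ⟨h1, h2, h3⟩ := hz1 z (hz z hzz).1
      have hb : ∀ i, D2 (f i) h z ^ 2 ≤ (2 * (K * ‖h‖ ^ δ)) ^ 2 := by
        intro i
        have e1 := hf i z h1 h hhS h2
        have e2 := hf i (z + h) h2 h hhS h3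
        rw [← sq_abs]
        gcongr
        calc |D2 (f i) h z| ≤ |f i (z + h + h) - f i (z + h)| + |f i (z + h) - f i z| :=
              abs_sub _ _
          _ ≤ _ := by linarith
      calc ∑ i, D2 (f i) h z ^ 2 ≤ ∑ _i : Fin (m + 1), (2 * (K * ‖h‖ ^ δ)) ^ 2 :=
            Finset.sum_le_sum fun i _ => hb i
        _ = G ^ 2 := by
            rw [hG, mul_pow q, hq2]
            simp
    have := hS a ha _ _ G y h r μ hr0 hG0 hμ0 hSol (hinv h hhS) hhr
      (fun z hzz => hμ z (hz z hzz).2)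
    have e : ‖h‖ / r * μ = μ / A := by
      rw [hr]; field_simp
    rwa [e] at this
  have c1 := abs_le.1 (claim x (by simp))
  have c2 := abs_le.1 (claim (x + h) (by simp))
  have hid := D2_identity v h x
  have hB : 0 ≤ μ / A := by positivity
  have hB2 : 0 ≤ A * K * (‖h‖ * ‖h‖ ^ δ) := by positivity
  have hle : 4 * (C * (μ / A + r * G)) ≤
      4 * C * (1 + 2 * q) * (μ / A + A * K * (‖h‖ * ‖h‖ ^ δ)) := by
    have e : r * G = 2 * q * (A * K * (‖h‖ * ‖h‖ ^ δ)) := by rw [hr, hG]; ring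
    rw [e]
    have : μ / A + 2 * q * (A * K * (‖h‖ * ‖h‖ ^ δ)) ≤
        (1 + 2 * q) * (μ / A + A * K * (‖h‖ * ‖h‖ ^ δ)) := by
      have := mul_nonneg hq0 hB
      nlinarith
    calc _ ≤ 4 * (C * ((1 + 2 * q) * (μ / A + A * K * (‖h‖ * ‖h‖ ^ δ)))) := by gcongr
      _ = _ := by ring
  have h4 : 4 * |D2 v h x| = |4 * D2 v h x| := by rw [abs_mul]; norm_num
  rw [h4, hid, abs_le]
  have t1 := abs_le.1 (le_refl |D2 v (h + h) x|)
  constructor <;> linarith [c1.1, c1.2, c2.1, c2.2, t1.1, t1.2]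

set_option maxHeartbeats 1000000 in
lemma zygmund (m : ℕ) (hm : 1 ≤ m) {ν δ : ℝ} (hν : 0 < ν) (hδ : δ ∈ Ioo (0 : ℝ) 1) :
    ∃ N : ℝ, 0 < N ∧
    ∀ (S : Submodule ℝ (EuclideanSpace ℝ (Fin (m + 1))))
      (a : Fin (m + 1) → Fin (m + 1) → EuclideanSpace ℝ (Fin (m + 1)) → ℝ), Ell ν a →
      (∀ h ∈ S, ∀ i j x, a i j (x + h) = a i j x) →
    ∀ (v : EuclideanSpace ℝ (Fin (m + 1)) → ℝ)
      (f : Fin (m + 1) → EuclideanSpace ℝ (Fin (m + 1)) → ℝ) (K M : ℝ), 0 ≤ K → 0 ≤ M →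
      Pre a v f (ball 0 (9 / 10)) → (∀ x, |v x| ≤ M) →
      (∀ i, ∀ x ∈ ball (0 : EuclideanSpace ℝ (Fin (m + 1))) (9 / 10), ∀ h ∈ S,
        x + h ∈ ball (0 : EuclideanSpace ℝ (Fin (m + 1))) (9 / 10) →
        |f i (x + h) - f i x| ≤ K * ‖h‖ ^ δ) →
    ∀ x ∈ ball (0 : EuclideanSpace ℝ (Fin (m + 1))) (4 / 5), ∀ h ∈ S,
      |D2 v h x| ≤ N * (K + M) * ‖h‖ ^ (1 + δ) := by
  obtain ⟨C, hC, hst⟩ := zyg_step m hm hν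
  obtain ⟨hδ0, hδ1⟩ := hδ
  set p := 1 + δ with hp
  have hp0 : 0 < p := by positivity
  have hp2 : p ≤ 2 := by linarith
  set θ : ℝ := 2 ^ p / 4 with hθ
  have h2p : (2 : ℝ) ^ p < 4 := by
    have : (2 : ℝ) ^ p < 2 ^ (2 : ℝ) := Real.rpow_lt_rpow_of_exponent_lt (by norm_num) (by linarith)
    norm_num at this; exact this
  have h2p0 : (0 : ℝ) < 2 ^ p := by positivity
  have hθ1 : θ < 1 := by rw [hθ]; linarith
  set A : ℝ := 1 + 2 * C / (1 - θ) with hA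
  have hθ' : 0 < 1 - θ := by linarith
  have hA1 : 1 ≤ A := by
    have : 0 ≤ 2 * C / (1 - θ) := by positivity
    linarith
  have hA0 : 0 < A := by linarith
  have hCA : C / A ≤ (1 - θ) / 2 := by
    rw [div_le_iff₀ hA0, hA]
    have : (1 - θ) / 2 * (1 + 2 * C / (1 - θ)) = (1 - θ) / 2 + C := by field_simp
    rw [this]; linarith
  set c0 : ℝ := C * A + 4 * (14 * A) ^ 2 with hc0
  have hc00 : 0 < c0 := by positivity
  refine ⟨100 * (2 / (1 - θ) * c0), by positivity, ?_⟩
  intro S a ha hinv v f K M hK hM hP hv hf x hx h hhS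
  by_cases hh : h = 0
  · subst hh
    have : D2 v 0 x = 0 := by simp [D2]
    rw [this, abs_zero]
    have : 0 ≤ 100 * (2 / (1 - θ) * c0) * (K + M) := by positivity
    exact mul_nonneg this (Real.rpow_nonneg (norm_nonneg _) _)
  have hh0 : 0 < ‖h‖ := norm_pos_iff.2 hh
  set ε := ‖h‖ with hε
  set T : Set ℝ := {t | ∃ x ∈ ball (0 : EuclideanSpace ℝ (Fin (m + 1))) (9 / 10), ∃ h ∈ S,
    ε ≤ ‖h‖ ∧ t = (9 / 10 - ‖x‖) ^ p * |D2 v h x| / ‖h‖ ^ p} with hT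
  have hTb : BddAbove T := by
    refine ⟨4 * M / ε ^ p, ?_⟩
    rintro t ⟨z, hz, k, hk, hεk, rfl⟩
    rw [mem_ball_zero_iff] at hz
    have h1 : (9 / 10 - ‖z‖) ^ p ≤ 1 :=
      Real.rpow_le_one (by linarith) (by linarith [norm_nonneg z]) hp0.le
    have h2 := D2_abs_le hv k z
    have h3 : (9 / 10 - ‖z‖) ^ p * |D2 v k z| ≤ 4 * M :=
      (mul_le_of_le_one_left (abs_nonneg _) h1).trans h2
    gcongr
  have hx' : x ∈ ball (0 : EuclideanSpace ℝ (Fin (m + 1))) (9 / 10) :=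
    ball_subset_ball (by norm_num) hx
  have hmem : (9 / 10 - ‖x‖) ^ p * |D2 v h x| / ‖h‖ ^ p ∈ T := ⟨x, hx', h, hhS, le_rfl, rfl⟩
  set Φ := sSup T with hΦ
  have hΦ0 : 0 ≤ Φ := by
    refine le_trans ?_ (le_csSup hTb hmem)
    rw [mem_ball_zero_iff] at hx'
    have : 0 ≤ 9 / 10 - ‖x‖ := by linarith
    positivity
  have hbd : ∀ z ∈ ball (0 : EuclideanSpace ℝ (Fin (m + 1))) (9 / 10), ∀ k ∈ S, ε ≤ ‖k‖ →
      (9 / 10 - ‖z‖) ^ p * |D2 v k z| ≤ Φ * ‖k‖ ^ p := by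
    intro z hz k hk hεk
    have : 0 < ‖k‖ ^ p := Real.rpow_pos_of_pos (by linarith) _
    rw [← div_le_iff₀ this]
    exact le_csSup hTb ⟨z, hz, k, hk, hεk, rfl⟩
  have hΦle : Φ ≤ (θ + C / A) * Φ + c0 * (K + M) := by
    refine csSup_le ⟨_, hmem⟩ ?_
    rintro t ⟨z, hz, k, hk, hεk, rfl⟩
    have hk0 : 0 < ‖k‖ := by linarith
    have hkne : k ≠ 0 := norm_pos_iff.1 hk0
    have hkp : 0 < ‖k‖ ^ p := Real.rpow_pos_of_pos hk0 _
    have hz' := mem_ball_zero_iff.1 hz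
    set ρ := 9 / 10 - ‖z‖ with hρ
    have hρ0 : 0 < ρ := by linarith
    have hρ1 : ρ ≤ 1 := by linarith [norm_nonneg z]
    have hρp : 0 < ρ ^ p := by positivity
    have hρp1 : ρ ^ p ≤ 1 := Real.rpow_le_one hρ0.le hρ1 hp0.le
    have hsum : 0 ≤ (θ + C / A) * Φ := by positivity
    rw [div_le_iff₀ hkp]
    by_cases hcase : 14 * (A * ‖k‖) < ρ
    · -- near case
      set Z := Φ * ‖k‖ ^ p / ρ ^ p with hZ
      have hZ0 : 0 ≤ Z := by positivity
      have hμ : ∀ y ∈ ball z (5 * (A * ‖k‖)), |D2 v k y| ≤ 4 * Z := by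
        intro y hy
        rw [mem_ball, dist_eq_norm] at hy
        have h1 : ‖y‖ ≤ ‖y - z‖ + ‖z‖ := by simpa using norm_add_le (y - z) z
        have h2 : ρ / 2 ≤ 9 / 10 - ‖y‖ := by linarith
        have h3 := hbd y (by rw [mem_ball_zero_iff]; linarith) k hk hεk
        have h4 : (ρ / 2) ^ p ≤ (9 / 10 - ‖y‖) ^ p :=
          Real.rpow_le_rpow (by positivity) h2 hp0.le
        have h5 : ρ ^ p ≤ 4 * (ρ / 2) ^ p := by
          rw [Real.div_rpow hρ0.le (by norm_num), ← mul_div_assoc, le_div_iff₀ h2p0]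
          nlinarith
        have h6 : ρ ^ p * |D2 v k y| ≤ 4 * (Φ * ‖k‖ ^ p) :=
          calc ρ ^ p * |D2 v k y| ≤ 4 * (ρ / 2) ^ p * |D2 v k y| := by gcongr
            _ = 4 * ((ρ / 2) ^ p * |D2 v k y|) := by ring
            _ ≤ 4 * ((9 / 10 - ‖y‖) ^ p * |D2 v k y|) := by gcongr
            _ ≤ _ := by gcongr
        rw [hZ, ← mul_div_assoc, le_div_iff₀ hρp]
        linarith
      have hs := hst S a ha hinv v f K δ hK hP hf z k A (4 * Z) hA1 hk hkne (by linarith) hμ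
      have hkk : ‖k + k‖ = 2 * ‖k‖ := by rw [← two_smul ℝ k, norm_smul]; norm_num
      have h2 := hbd z hz (k + k) (S.add_mem hk hk) (by rw [hkk]; linarith)
      rw [hkk, Real.mul_rpow (by norm_num) hk0.le] at h2
      have e1 : ‖k‖ * ‖k‖ ^ δ = ‖k‖ ^ p := by
        rw [hp, Real.rpow_add hk0, Real.rpow_one]
      rw [e1] at hs
      have e2 : ρ ^ p * Z = Φ * ‖k‖ ^ p := by rw [hZ]; field_simp
      have h3 : ρ ^ p * (4 * |D2 v k z|) ≤ ρ ^ p * (|D2 v (k + k) z| +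
          C * (4 * Z / A + A * K * ‖k‖ ^ p)) := mul_le_mul_of_nonneg_left hs hρp.le
      have e3 : ρ ^ p * (|D2 v (k + k) z| + C * (4 * Z / A + A * K * ‖k‖ ^ p))
          = ρ ^ p * |D2 v (k + k) z| + 4 * (C / A) * (ρ ^ p * Z)
            + ρ ^ p * (C * A * K * ‖k‖ ^ p) := by ring
      have h4 : ρ ^ p * (C * A * K * ‖k‖ ^ p) ≤ C * A * K * ‖k‖ ^ p :=
        mul_le_of_le_one_left (by positivity) hρp1
      rw [e3, e2] at h3
      have e4 : 2 ^ p = 4 * θ := by rw [hθ]; ring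
      rw [e4] at h2
      have h5 : C * A * K * ‖k‖ ^ p ≤ c0 * (K + M) * ‖k‖ ^ p := by
        gcongr
        · linarith [sq_nonneg (14 * A)]
        · linarith
      have h6 : 0 ≤ C * A * K * ‖k‖ ^ p := by positivity
      have h7 : ((θ + C / A) * Φ + c0 * (K + M)) * ‖k‖ ^ p
          = (Φ * (4 * θ * ‖k‖ ^ p) + 4 * (C / A) * (Φ * ‖k‖ ^ p)) / 4
            + c0 * (K + M) * ‖k‖ ^ p := by ring
      rw [h7]
      linarith
    · -- far case
      push Not at hcase
      have h1 := D2_abs_le hv k z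
      have h2 : ρ ^ p ≤ (14 * A) ^ 2 * ‖k‖ ^ p := by
        calc ρ ^ p ≤ (14 * A * ‖k‖) ^ p := Real.rpow_le_rpow hρ0.le (by linarith) hp0.le
          _ = (14 * A) ^ p * ‖k‖ ^ p := Real.mul_rpow (by positivity) hk0.le
          _ ≤ (14 * A) ^ (2 : ℝ) * ‖k‖ ^ p := by
              gcongr
              linarith
          _ = _ := by norm_cast
      have h3 : ρ ^ p * |D2 v k z| ≤ (14 * A) ^ 2 * ‖k‖ ^ p * (4 * M) := by gcongr
      have h4 : (14 * A) ^ 2 * ‖k‖ ^ p * (4 * M) ≤ c0 * (K + M) * ‖k‖ ^ p := by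
        have : 4 * (14 * A) ^ 2 * M ≤ c0 * (K + M) := by
          gcongr
          · have : 0 < C * A := by positivity
            linarith
          · linarith
        calc _ = 4 * (14 * A) ^ 2 * M * ‖k‖ ^ p := by ring
          _ ≤ _ := by gcongr
      have h5 : 0 ≤ (θ + C / A) * Φ * ‖k‖ ^ p := by positivity
      calc _ ≤ _ := h3
        _ ≤ _ := h4
        _ ≤ _ := by rw [add_mul]; linarith
  have hΦ2 : Φ ≤ 2 / (1 - θ) * c0 * (K + M) := by
    have h1 : (θ + C / A) * Φ ≤ (θ + (1 - θ) / 2) * Φ := by gcongr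
    have h2 : (1 - θ) / 2 * Φ ≤ c0 * (K + M) := by linarith
    have e : 2 / (1 - θ) * c0 * (K + M) = c0 * (K + M) / ((1 - θ) / 2) := by field_simp
    rw [e, le_div_iff₀ (by positivity)]; linarith
  have h1 := hbd x hx' h hhS le_rfl
  rw [mem_ball_zero_iff] at hx
  have h2 : (1 : ℝ) / 100 ≤ (9 / 10 - ‖x‖) ^ p := by
    calc (1 : ℝ) / 100 = (1 / 10) ^ (2 : ℝ) := by norm_num
      _ ≤ (1 / 10) ^ p := Real.rpow_le_rpow_of_exponent_ge (by norm_num) (by norm_num) hp2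
      _ ≤ _ := Real.rpow_le_rpow (by norm_num) (by linarith) hp0.le
  have h3 : 1 / 100 * |D2 v h x| ≤ 2 / (1 - θ) * c0 * (K + M) * ‖h‖ ^ p :=
    calc 1 / 100 * |D2 v h x| ≤ (9 / 10 - ‖x‖) ^ p * |D2 v h x| := by gcongr
      _ ≤ Φ * ‖h‖ ^ p := h1
      _ ≤ _ := by gcongr
  linarith

lemma quot_tendsto {d : ℕ} {v : EuclideanSpace ℝ (Fin d) → ℝ} (hv : ContDiff ℝ 1 v)
    (x e : EuclideanSpace ℝ (Fin d)) {t : ℝ} (ht : 0 < t) :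
    Tendsto (fun n : ℕ => (v (x + (t / 2 ^ n) • e) - v x) / (t / 2 ^ n)) atTop
      (nhds (fderiv ℝ v x e)) := by
  have h1 : HasDerivAt (fun s : ℝ => v (x + s • e)) (fderiv ℝ v x e) 0 := by
    have h2 : HasDerivAt (fun s : ℝ => x + s • e) e 0 := by
      simpa using ((hasDerivAt_id (0 : ℝ)).smul_const e).const_add x
    have h3 : HasFDerivAt v (fderiv ℝ v x) (x + (0 : ℝ) • e) := by
      simpa using (hv.differentiable (by simp) x).hasFDerivAt
    exact h3.comp_hasDerivAt (0 : ℝ) h2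
  have h4 := h1.tendsto_slope_zero
  have h5 : Tendsto (fun n : ℕ => t / 2 ^ n) atTop (nhdsWithin 0 {0}ᶜ) := by
    rw [tendsto_nhdsWithin_iff]
    constructor
    · have := (tendsto_pow_atTop_nhds_zero_of_lt_one (r := (1 / 2 : ℝ)) (by norm_num)
        (by norm_num)).const_mul t
      rw [mul_zero] at this
      refine this.congr fun n => ?_
      rw [one_div, inv_pow]; rfl
    · exact Eventually.of_forall fun n => by
        have : t / 2 ^ n ≠ 0 := by positivity
        exact this
  refine (h4.comp h5).congr fun n => ?_
  simp only [Function.comp, zero_add, zero_smul, add_zero, smul_eq_mul]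
  rw [inv_mul_eq_div]

lemma quot_bound {d : ℕ} {δ L : ℝ} (hδ : 0 < δ) (hL : 0 ≤ L)
    {v : EuclideanSpace ℝ (Fin d) → ℝ} (hv : ContDiff ℝ 1 v)
    (x e : EuclideanSpace ℝ (Fin d)) (he : ‖e‖ = 1)
    (hD : ∀ t : ℝ, |D2 v (t • e) x| ≤ L * ‖t • e‖ ^ (1 + δ)) {t : ℝ} (ht : 0 < t) :
    |(v (x + t • e) - v x) / t - fderiv ℝ v x e| ≤ L / (1 - 2⁻¹ ^ δ) * t ^ δ := by
  have hγ : (2⁻¹ : ℝ) ^ δ < 1 := Real.rpow_lt_one (by norm_num) (by norm_num) hδ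
  set c := L / (1 - (2⁻¹ : ℝ) ^ δ) with hc
  have hc0 : 0 ≤ c := div_nonneg hL (by linarith)
  have hcL : c * (1 - (2⁻¹ : ℝ) ^ δ) = L := div_mul_cancel₀ _ (by linarith)
  set q : ℝ → ℝ := fun s => (v (x + s • e) - v x) / s with hq
  have step : ∀ s : ℝ, 0 < s → |q s - q (s / 2)| ≤ c * (s ^ δ - (s / 2) ^ δ) := by
    intro s hs
    have e1 : q s - q (s / 2) = D2 v ((s / 2) • e) x / s := by
      have : x + (s / 2) • e + (s / 2) • e = x + s • e := by
        rw [add_assoc, ← add_smul, add_halves]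
      simp only [hq, D2, this]
      field_simp
      ring
    have e2 : ‖(s / 2) • e‖ = s / 2 := by
      rw [norm_smul, he, mul_one, Real.norm_eq_abs, abs_of_pos (by positivity)]
    have h1 := hD (s / 2)
    rw [e2] at h1
    rw [e1, abs_div, abs_of_pos hs, div_le_iff₀ hs]
    have e3 : (s / 2) ^ δ = s ^ δ * 2⁻¹ ^ δ := by
      rw [div_eq_mul_inv, Real.mul_rpow hs.le (by norm_num)]
    have e4 : c * (s ^ δ - (s / 2) ^ δ) = L * s ^ δ := by
      rw [e3, ← hcL]; ring
    rw [e4]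
    refine h1.trans ?_
    rw [Real.rpow_add (by positivity), Real.rpow_one]
    have h5 : (s / 2) ^ δ ≤ s ^ δ := Real.rpow_le_rpow (by positivity) (by linarith) hδ.le
    calc L * (s / 2 * (s / 2) ^ δ) ≤ L * (s * s ^ δ) := by
          gcongr
          linarith
      _ = _ := by ring
  have tele : ∀ n : ℕ, |q t - q (t / 2 ^ n)| ≤ c * (t ^ δ - (t / 2 ^ n) ^ δ) := by
    intro n
    induction n with
    | zero => simp
    | succ n ih =>
      have h1 := step (t / 2 ^ n) (by positivity)
      have e1 : t / 2 ^ n / 2 = t / 2 ^ (n + 1) := by rw [pow_succ, div_div]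
      rw [e1] at h1
      have h2 := abs_sub_le (q t) (q (t / 2 ^ n)) (q (t / 2 ^ (n + 1)))
      nlinarith
  have lim := (quot_tendsto hv x e ht).const_sub (q t) |>.abs
  refine le_of_tendsto lim (Eventually.of_forall fun n => (tele n).trans ?_)
  have : 0 ≤ (t / 2 ^ n) ^ δ := by positivity
  gcongr
  linarith

lemma zyg_holder {δ : ℝ} (hδ : δ ∈ Ioo (0 : ℝ) 1) : ∃ N : ℝ, 0 < N ∧
    ∀ (d : ℕ) (S : Submodule ℝ (EuclideanSpace ℝ (Fin d)))
      (v : EuclideanSpace ℝ (Fin d) → ℝ) (L M : ℝ), 0 ≤ L → 0 ≤ M → ContDiff ℝ 1 v →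
      (∀ x, |v x| ≤ M) →
      (∀ x ∈ ball (0 : EuclideanSpace ℝ (Fin d)) (4 / 5), ∀ h ∈ S,
        |D2 v h x| ≤ L * ‖h‖ ^ (1 + δ)) →
      ∀ e ∈ S, ‖e‖ = 1 → ∀ x ∈ ball (0 : EuclideanSpace ℝ (Fin d)) (1 / 2),
        ∀ y ∈ ball (0 : EuclideanSpace ℝ (Fin d)) (1 / 2), y - x ∈ S →
        |fderiv ℝ v x e - fderiv ℝ v y e| ≤ N * (L + M) * ‖y - x‖ ^ δ := by
  obtain ⟨hδ0, hδ1⟩ := hδ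
  have hγ : (2⁻¹ : ℝ) ^ δ < 1 := Real.rpow_lt_one (by norm_num) (by norm_num) hδ0
  set B : ℝ := 1 / (1 - (2⁻¹ : ℝ) ^ δ) with hB
  have hγ' : 0 < 1 - (2⁻¹ : ℝ) ^ δ := by linarith
  have hB0 : 0 < B := by positivity
  refine ⟨64 + 8 * B, by positivity, ?_⟩
  intro d S v L M hL hM hv hvM hD e heS he x hx y hy hxy
  have hq : ∀ z ∈ ball (0 : EuclideanSpace ℝ (Fin d)) (1 / 2), ∀ t : ℝ, 0 < t →
      |(v (z + t • e) - v z) / t - fderiv ℝ v z e| ≤ B * L * t ^ δ := by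
    intro z hz t ht
    have := quot_bound hδ0 hL hv z e he
      (fun s => hD z (ball_subset_ball (by norm_num) hz) (s • e) (S.smul_mem s heS)) ht
    have e1 : B * L = L / (1 - (2⁻¹ : ℝ) ^ δ) := by rw [hB]; ring
    rwa [e1]
  set t := ‖y - x‖ with ht
  rcases lt_or_ge t (1 / 4) with h4 | h4
  · rcases (norm_nonneg (y - x)).eq_or_lt with h0 | h0
    · have : y = x := by
        have := norm_eq_zero.1 h0.symm
        exact sub_eq_zero.1 this
      subst this
      rw [sub_self, abs_zero]
      positivity
    · rw [← ht] at h0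
      have hx1 := hq x hx t h0
      have hy1 := hq y hy t h0
      set m := (2⁻¹ : ℝ) • ((y - x) + t • e) with hm
      set n := (2⁻¹ : ℝ) • ((y - x) - t • e) with hn
      have hte : ‖t • e‖ = t := by rw [norm_smul, he, mul_one, Real.norm_eq_abs, abs_of_pos h0]
      have hmS : m ∈ S := S.smul_mem _ (S.add_mem hxy (S.smul_mem _ heS))
      have hnS : n ∈ S := S.smul_mem _ (S.sub_mem hxy (S.smul_mem _ heS))
      have hmt : ‖m‖ ≤ t := by
        rw [hm, norm_smul]
        have := norm_add_le (y - x) (t • e)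
        rw [hte, ← ht] at this
        norm_num; linarith
      have hnt : ‖n‖ ≤ t := by
        rw [hn, norm_smul]
        have := norm_sub_le (y - x) (t • e)
        rw [hte, ← ht] at this
        norm_num; linarith
      have hmm : m + m = (y - x) + t • e := by
        rw [← two_smul ℝ m, hm, smul_smul]; norm_num
      have hnn : n + n = (y - x) - t • e := by
        rw [← two_smul ℝ n, hn, smul_smul]; norm_num
      have hmn : m = t • e + n := by
        rw [hm, hn, smul_sub, smul_add]
        have : t • e = (2⁻¹ : ℝ) • (t • e) + (2⁻¹ : ℝ) • (t • e) := by
          rw [← add_smul]; norm_num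
        nth_rewrite 2 [this]
        abel
      have hx' := mem_ball_zero_iff.1 hx
      have hd1 := hD x (ball_subset_ball (by norm_num) hx) m hmS
      have hd2 := hD (x + t • e) (by
        rw [mem_ball_zero_iff]
        have := norm_add_le x (t • e)
        linarith) n hnS
      have hp : t ^ (1 + δ) = t * t ^ δ := by rw [Real.rpow_add h0, Real.rpow_one]
      have hd1' : |D2 v m x| ≤ L * (t * t ^ δ) := by
        rw [← hp]
        refine hd1.trans ?_
        gcongr
      have hd2' : |D2 v n (x + t • e)| ≤ L * (t * t ^ δ) := by
        rw [← hp]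
        refine hd2.trans ?_
        gcongr
      have hid : (v (y + t • e) - v y) - (v (x + t • e) - v x)
          = D2 v m x - D2 v n (x + t • e) := by
        have e1 : x + m + m = y + t • e := by rw [add_assoc, hmm]; abel
        have e2 : x + t • e + n + n = y := by rw [add_assoc, hnn]; abel
        have e3 : x + t • e + n = x + m := by rw [hmn]; abel
        simp only [D2, e1, e2]
        rw [e3]; ring
      have hquot : |(v (y + t • e) - v y) / t - (v (x + t • e) - v x) / t| ≤ 2 * L * t ^ δ := by
        rw [← sub_div, hid, abs_div, abs_of_pos h0, div_le_iff₀ h0]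
        calc _ ≤ |D2 v m x| + |D2 v n (x + t • e)| := abs_sub _ _
          _ ≤ _ := by linarith
      have htp : 0 ≤ t ^ δ := by positivity
      have hfin : |fderiv ℝ v x e - fderiv ℝ v y e| ≤ (2 * L + 2 * (B * L)) * t ^ δ := by
        rw [abs_le] at hx1 hy1 hquot ⊢
        constructor <;> linarith [hx1.1, hx1.2, hy1.1, hy1.2, hquot.1, hquot.2]
      refine hfin.trans ?_
      gcongr
      have := mul_nonneg hB0.le hM
      have := mul_nonneg hB0.le hL
      nlinarith
  · have hb : ∀ z ∈ ball (0 : EuclideanSpace ℝ (Fin d)) (1 / 2),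
        |fderiv ℝ v z e| ≤ 8 * M + B * L := by
      intro z hz
      have h1 := hq z hz (1 / 4) (by norm_num)
      have h2 : ((1 : ℝ) / 4) ^ δ ≤ 1 := Real.rpow_le_one (by norm_num) (by norm_num) hδ0.le
      have h3 : B * L * (1 / 4 : ℝ) ^ δ ≤ B * L := mul_le_of_le_one_right (by positivity) h2
      have h4 := abs_le.1 (hvM z)
      have h5 := abs_le.1 (hvM (z + (1 / 4 : ℝ) • e))
      rw [abs_le] at h1 ⊢
      constructor <;> linarith [h1.1, h1.2, h4.1, h4.2, h5.1, h5.2]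
    have h5 : (1 : ℝ) / 4 ≤ t ^ δ := by
      calc (1 : ℝ) / 4 = (1 / 4) ^ (1 : ℝ) := by norm_num
        _ ≤ (1 / 4) ^ δ := Real.rpow_le_rpow_of_exponent_ge (by norm_num) (by norm_num) hδ1.le
        _ ≤ _ := Real.rpow_le_rpow (by norm_num) h4 hδ0.le
    have h6 : |fderiv ℝ v x e - fderiv ℝ v y e| ≤ 16 * M + 2 * (B * L) := by
      have h1 := abs_le.1 (hb x hx)
      have h2 := abs_le.1 (hb y hy)
      rw [abs_le]
      constructor <;> linarith [h1.1, h1.2, h2.1, h2.2]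
    have h7 : (16 * M + 2 * (B * L)) ≤ (64 + 8 * B) * (L + M) * (1 / 4) := by
      have := mul_nonneg hB0.le hM
      nlinarith
    refine h6.trans (h7.trans ?_)
    gcongr

lemma localize {d : ℕ} {ν : ℝ} {a : Fin d → Fin d → EuclideanSpace ℝ (Fin d) → ℝ}
    (ha : Ell ν a) {u : EuclideanSpace ℝ (Fin d) → ℝ} {fv : Fin d → EuclideanSpace ℝ (Fin d) → ℝ}
    {M : ℝ} (hu : ContDiffOn ℝ 1 u (ball (0 : EuclideanSpace ℝ (Fin d)) 1))
    (hf : ∀ i, IntegrableOn (fv i) (ball (0 : EuclideanSpace ℝ (Fin d)) 1))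
    (hw : ∀ φ : EuclideanSpace ℝ (Fin d) → ℝ, ContDiff ℝ (⊤ : ℕ∞) φ →
          HasCompactSupport φ → tsupport φ ⊆ ball (0 : EuclideanSpace ℝ (Fin d)) 1 →
          ∫ x in ball (0 : EuclideanSpace ℝ (Fin d)) 1,
              ∑ i, ∑ j, a i j x * pd j u x * pd i φ x
            = ∫ x in ball (0 : EuclideanSpace ℝ (Fin d)) 1,
                ∑ i, fv i x * pd i φ x)
    (hM : 0 ≤ M) (huM : ∀ x ∈ ball (0 : EuclideanSpace ℝ (Fin d)) 1, |u x| ≤ M) :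
    ∃ v : EuclideanSpace ℝ (Fin d) → ℝ,
      Pre a v (fun i => (ball (0 : EuclideanSpace ℝ (Fin d)) 1).indicator (fv i)) (ball 0 (9 / 10)) ∧
      (∀ x, |v x| ≤ M) ∧
      ∀ x ∈ ball (0 : EuclideanSpace ℝ (Fin d)) (9 / 10), fderiv ℝ v x = fderiv ℝ u x := by
  let χ : ContDiffBump (0 : EuclideanSpace ℝ (Fin d)) := ⟨9 / 10, 95 / 100, by norm_num, by norm_num⟩
  have hts : tsupport χ ⊆ ball (0 : EuclideanSpace ℝ (Fin d)) 1 := by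
    rw [χ.tsupport_eq]
    exact closedBall_subset_ball (by norm_num)
  have hsm : ContDiff ℝ 1 χ := χ.contDiff
  set v : EuclideanSpace ℝ (Fin d) → ℝ := fun x => χ x * u x with hv
  have hv1 : ContDiff ℝ 1 v := by
    rw [contDiff_iff_contDiffAt]
    intro x
    by_cases hx : x ∈ ball (0 : EuclideanSpace ℝ (Fin d)) 1
    · exact hsm.contDiffAt.mul (hu.contDiffAt (isOpen_ball.mem_nhds hx))
    · have hx' : x ∉ tsupport χ := fun h => hx (hts h)
      have h0 := notMem_tsupport_iff_eventuallyEq.1 hx'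
      refine (contDiffAt_const (c := (0 : ℝ))).congr_of_eventuallyEq ?_
      filter_upwards [h0] with z hz
      simp [hv, hz]
  have hvc : HasCompactSupport v := χ.hasCompactSupport.mul_right
  have hfd : ∀ x ∈ ball (0 : EuclideanSpace ℝ (Fin d)) (9 / 10), fderiv ℝ v x = fderiv ℝ u x := by
    intro x hx
    apply Filter.EventuallyEq.fderiv_eq
    filter_upwards [isOpen_ball.mem_nhds hx] with z hz
    have : χ z = 1 := χ.one_of_mem_closedBall (ball_subset_closedBall hz)
    simp [hv, this]
  have hfi : ∀ i, Integrable ((ball (0 : EuclideanSpace ℝ (Fin d)) 1).indicator (fv i)) := fun i =>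
    (hf i).integrable_indicator measurableSet_ball
  refine ⟨v, ⟨hv1, hvc, hfi, ?_⟩, ?_, hfd⟩
  · refine weakDiv_of_smooth isOpen_ball
      (fun i => (ha.integrable_flux hv1 hvc i).sub (hfi i)) ?_
    intro φ h1 h2 h3
    have h1' : ContDiff ℝ 1 φ := h1.of_le (by exact_mod_cast le_top)
    have hsub : ball (0 : EuclideanSpace ℝ (Fin d)) (9 / 10) ⊆ ball 0 1 :=
      ball_subset_ball (by norm_num)
    have h4 := hw φ h1 h2 (h3.trans hsub)
    have hout : ∀ x, x ∉ ball (0 : EuclideanSpace ℝ (Fin d)) 1 → ∀ i, pd i φ x = 0 := fun x hx i =>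
      pd_eq_zero (fun h => hx (hsub (h3 h))) i
    have e1 : ∫ x, ∑ i, (∑ j, a i j x * pd j v x) * pd i φ x
        = ∫ x in ball (0 : EuclideanSpace ℝ (Fin d)) 1,
              ∑ i, ∑ j, a i j x * pd j u x * pd i φ x := by
      rw [← setIntegral_eq_integral_of_forall_compl_eq_zero
        (s := ball (0 : EuclideanSpace ℝ (Fin d)) 1)]
      · refine setIntegral_congr_fun measurableSet_ball fun x _ => ?_
        refine Finset.sum_congr rfl fun i _ => ?_
        rw [Finset.sum_mul]
        refine Finset.sum_congr rfl fun j _ => ?_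
        by_cases hx : x ∈ tsupport φ
        · simp only [pd, hfd x (h3 hx)]
        · rw [pd_eq_zero hx, mul_zero, mul_zero]
      · intro x hx
        exact Finset.sum_eq_zero fun i _ => by rw [hout x hx, mul_zero]
    have e2 : ∫ x, ∑ i, (ball (0 : EuclideanSpace ℝ (Fin d)) 1).indicator (fv i) x * pd i φ x
        = ∫ x in ball (0 : EuclideanSpace ℝ (Fin d)) 1, ∑ i, fv i x * pd i φ x := by
      rw [← setIntegral_eq_integral_of_forall_compl_eq_zero
        (s := ball (0 : EuclideanSpace ℝ (Fin d)) 1)]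
      · refine setIntegral_congr_fun measurableSet_ball fun x hx => ?_
        refine Finset.sum_congr rfl fun i _ => ?_
        rw [indicator_of_mem hx]
      · intro x hx
        exact Finset.sum_eq_zero fun i _ => by rw [hout x hx, mul_zero]
    simp_rw [sub_mul, Finset.sum_sub_distrib]
    rw [integral_sub, e1, e2, h4, sub_self]
    · exact integrable_finsetSum _ fun i _ =>
        integrable_mul_pd (ha.integrable_flux hv1 hvc i) h1' h2 i
    · exact integrable_finsetSum _ fun i _ => integrable_mul_pd (hfi i) h1' h2 i
  · intro x
    by_cases hx : x ∈ ball (0 : EuclideanSpace ℝ (Fin d)) 1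
    · rw [hv]
      simp only [abs_mul]
      rw [abs_of_nonneg χ.nonneg]
      calc χ x * |u x| ≤ 1 * M := by
            gcongr
            · exact χ.le_one
            · exact huM x hx
        _ = M := one_mul M
    · have : χ x = 0 := image_eq_zero_of_notMem_tsupport (fun h => hx (hts h))
      simpa [hv, this] using hM

/-- vectors whose last coordinates vanish -/
def firstCoords (d q : ℕ) : Submodule ℝ (EuclideanSpace ℝ (Fin d)) where
  carrier := {h | ∀ i : Fin d, q ≤ (i : ℕ) → h i = 0}
  add_mem' := by
    intro x y hx hy i hi
    simp [hx i hi, hy i hi]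
  zero_mem' := by
    intro i _
    simp
  smul_mem' := by
    intro c x hx i hi
    simp [hx i hi]

/-- **Theorem 2.1 (iii)**: interior partial Schauder estimate on the unit ball for
divergence form elliptic equations with coefficients independent of `x'`. -/
theorem partial_schauder_elliptic_div_ball
    (d q : ℕ) (ν δ : ℝ) (hd : 2 ≤ d) (hq1 : 1 ≤ q) (hqd : q < d)
    (hν : ν ∈ Ioc (0 : ℝ) 1) (hδ : δ ∈ Ioo (0 : ℝ) 1) :
    ∃ N : ℝ, 0 < N ∧
      ∀ (a : Fin d → Fin d → EuclideanSpace ℝ (Fin d) → ℝ)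
        (u : EuclideanSpace ℝ (Fin d) → ℝ)
        (fv : Fin d → EuclideanSpace ℝ (Fin d) → ℝ),
        (∀ i j, Measurable (a i j)) →
        -- coercivity (lower ellipticity bound)
        (∀ (x : EuclideanSpace ℝ (Fin d)) (ξ : Fin d → ℝ),
          ν * ∑ i, ξ i ^ 2 ≤ ∑ i, ∑ j, a i j x * ξ i * ξ j) →
        -- boundedness: `Σ |a^{ij}|² ≤ ν⁻²`
        (∀ x : EuclideanSpace ℝ (Fin d), ∑ i, ∑ j, a i j x ^ 2 ≤ ν⁻¹ ^ 2) →
        (∀ i j (x y : EuclideanSpace ℝ (Fin d)),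
          (∀ k : Fin d, q ≤ (k : ℕ) → x k = y k) → a i j x = a i j y) →
        ContDiffOn ℝ 1 u (ball (0 : EuclideanSpace ℝ (Fin d)) 1) →
        (∀ i, IntegrableOn (fv i) (ball (0 : EuclideanSpace ℝ (Fin d)) 1)) →
        -- weak formulation of `D_i (a^{ij} D_j u) = div f⃗` in `B_1`
        (∀ φ : EuclideanSpace ℝ (Fin d) → ℝ, ContDiff ℝ (⊤ : ℕ∞) φ →
          HasCompactSupport φ → tsupport φ ⊆ ball (0 : EuclideanSpace ℝ (Fin d)) 1 →
          ∫ x in ball (0 : EuclideanSpace ℝ (Fin d)) 1,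
              ∑ i, ∑ j, a i j x * pd j u x * pd i φ x
            = ∫ x in ball (0 : EuclideanSpace ℝ (Fin d)) 1,
                ∑ i, fv i x * pd i φ x) →
        ∀ K M : ℝ, 0 ≤ K →
          (∀ i, PHolderX d q δ (ball (0 : EuclideanSpace ℝ (Fin d)) 1) (fv i) K) →
          (∀ x ∈ ball (0 : EuclideanSpace ℝ (Fin d)) 1, |u x| ≤ M) →
          ∀ i : Fin d, (i : ℕ) < q →
            PHolderX d q δ (ball (0 : EuclideanSpace ℝ (Fin d)) (1/2))
              (pd i u) (N * (K + M)) := by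
  obtain ⟨m, rfl⟩ : ∃ m, d = m + 1 := ⟨d - 1, by omega⟩
  have hm : 1 ≤ m := by omega
  obtain ⟨hν0, _⟩ := hν
  obtain ⟨N1, hN1, hz⟩ := zygmund m hm hν0 hδ
  obtain ⟨N2, hN2, hH⟩ := zyg_holder hδ
  refine ⟨N2 * (N1 + 1), by positivity, ?_⟩
  intro a u fv hmeas hcoer hbdd hind hu hf hw K M hK hfK huM i hi
  have ha : Ell ν a := ⟨hν0, hmeas, hcoer, hbdd⟩
  have hM : 0 ≤ M := (abs_nonneg _).trans (huM 0 (mem_ball_self one_pos))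
  obtain ⟨v, hP, hvM, hfd⟩ := localize ha hu hf hw hM huM
  set S := firstCoords (m + 1) q with hS
  have hSmem : ∀ h, h ∈ S ↔ ∀ i : Fin (m + 1), q ≤ (i : ℕ) → h i = 0 := fun h => Iff.rfl
  have hzyg := hz S a ha (fun h hh i j x => hind i j _ _ fun k hk => by
      simp [(hSmem h).1 hh k hk]) v _ K M hK hM hP hvM (by
    intro i x hx h hh hxh
    have hsub : ball (0 : EuclideanSpace ℝ (Fin (m + 1))) (9 / 10) ⊆ ball 0 1 :=
      ball_subset_ball (by norm_num)
    rw [indicator_of_mem (hsub hx), indicator_of_mem (hsub hxh)]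
    have := hfK i (x + h) (hsub hxh) x (hsub hx) fun k hk => by
      simp [(hSmem h).1 hh k hk]
    simpa [dist_eq_norm] using this)
  have heS : EuclideanSpace.single i (1 : ℝ) ∈ S := by
    rw [hSmem]
    intro k hk
    have : k ≠ i := by
      rintro rfl
      omega
    simp [this]
  have hmain := hH (m + 1) S v (N1 * (K + M)) M (by positivity) hM hP.hw hvM hzyg
    (EuclideanSpace.single i 1) heS (by simp)
  intro x hx y hy hxy
  have hsub : ball (0 : EuclideanSpace ℝ (Fin (m + 1))) (1 / 2) ⊆ ball 0 (9 / 10) :=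
    ball_subset_ball (by norm_num)
  have := hmain x hx y hy (by
    rw [hSmem]
    intro k hk
    simp [hxy k hk])
  rw [hfd x (hsub hx), hfd y (hsub hy)] at this
  refine this.trans ?_
  rw [dist_comm, dist_eq_norm]
  refine mul_le_mul_of_nonneg_right ?_ (Real.rpow_nonneg (norm_nonneg _) _)
  rw [mul_assoc]
  refine mul_le_mul_of_nonneg_left ?_ hN2.le
  linarith
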